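/- arXiv:2111.13399 — 3 statements merged into one kernel-verified Lean document; each statement's English description precedes it below -/
import Mathlib

section
/- Let p ≥ 2. A triple (a,b,c) ∈ (ℝ^2_{++})^3 belongs to Singular(p,2) if and only if, for every permutation (x,y,z) of (a,b,c), the following inequalities hold: (Weyl) x_1 + y_1 ≥ z_1 and x_1 + y_2 ≥ z_2; (Lidskii) x_1 + x_2 + y_1 + y_2 ≥ z_1 + z_2; (signed Lidskii) x_1 + x_2 + y_1 − y_2 ≥ z_1 − z_2. (This amounts to 18 distinct inequalities.) -/
open Matrix

/-- The eigenvalues of a Hermitian matrix, listed in decreasing order. -/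
noncomputable def eigsDesc {n : ℕ} {A : Matrix (Fin n) (Fin n) ℂ} (hA : A.IsHermitian) :
    Fin n → ℝ :=
  fun i => hA.eigenvalues (Tuple.sort hA.eigenvalues i.rev)

/-- The singular values of a complex `p × q` matrix, listed in decreasing order:
the square roots of the eigenvalues of the Hermitian matrix `Aᴴ * A`. -/
noncomputable def singularValues {p q : ℕ} (A : Matrix (Fin p) (Fin q) ℂ) : Fin q → ℝ :=
  fun i => Real.sqrt (eigsDesc (Matrix.isHermitian_conjTranspose_mul_self A) i)

/-- `sval A k` is the `k`-th singular value `τ_k(A)` of `A`, with 1-based indexing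
(junk value `0` out of range). -/
noncomputable def sval {p q : ℕ} (A : Matrix (Fin p) (Fin q) ℂ) (k : ℕ) : ℝ :=
  if h : k - 1 < q then singularValues A ⟨k - 1, h⟩ else 0

/-- `SingularCone p q` is the set of triples `(τ(A), τ(B), τ(C))` of singular value vectors
of complex `p × q` matrices `A`, `B`, `C` with `A + B + C = 0`. -/
def SingularCone (p q : ℕ) : Set ((Fin q → ℝ) × (Fin q → ℝ) × (Fin q → ℝ)) :=
  {t | ∃ A B C : Matrix (Fin p) (Fin q) ℂ, A + B + C = 0 ∧
      singularValues A = t.1 ∧ singularValues B = t.2.1 ∧ singularValues C = t.2.2}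

/-- The real part of `tr (Aᴴ * B)` for `A = diag(a₁, a₂)` and `B = -R * diag(b₁ z, b₂) * R`, where
`z` is a unit complex number with real part `x` and `R` is a rotation with squared cosine `t`. -/
def diagPairing (a₁ a₂ b₁ b₂ x t : ℝ) : ℝ :=
  -b₁ * x * ((a₁ + a₂) * t - a₂) + b₂ * (a₁ - (a₁ + a₂) * t)

/-- The squared modulus of `det (A + B)` for the same matrices `A` and `B` as in `diagPairing`. -/
def detNormSq (a₁ a₂ b₁ b₂ x t : ℝ) : ℝ :=
  (a₁ * a₂ + b₂ * (a₂ - (a₁ + a₂) * t)) ^ 2 + (b₁ * (b₂ + a₁ - (a₁ + a₂) * t)) ^ 2 +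
    2 * (a₁ * a₂ + b₂ * (a₂ - (a₁ + a₂) * t)) * (b₁ * (b₂ + a₁ - (a₁ + a₂) * t)) * x

lemma sq_add_sq_le_of_add_le {u v x y : ℝ} (hv : 0 ≤ v) (hy : 0 ≤ y) (h₁ : -x ≤ u) (h₂ : u ≤ x)
    (h₃ : v ≤ x) (h₄ : u + v ≤ x + y) (h₅ : -u + v ≤ x + y) :
    u ^ 2 + v ^ 2 ≤ x ^ 2 + y ^ 2 := by
  wlog hu : 0 ≤ u generalizing u
  · rw [← neg_sq u]
    exact this (u := -u) (by linarith) (by linarith) h₅ (by linarith) (by linarith)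
  rcases le_total (u + v) x with h | h
  · nlinarith [mul_nonneg hu hv, sq_nonneg y]
  · nlinarith [mul_nonneg (sub_nonneg.2 h₂) (sub_nonneg.2 h₃),
      pow_le_pow_left₀ (sub_nonneg.2 h) (by linarith : u + v - x ≤ y) 2]

lemma half_sub_sq_sq_le {x y e : ℝ} (hxy : y ≤ x) (h₁ : x - y ≤ e)
    (h₂ : e ≤ x + y) : ((x ^ 2 + y ^ 2 - e ^ 2) / 2) ^ 2 ≤ (x * y) ^ 2 := by
  have h₃ := pow_le_pow_left₀ (sub_nonneg.2 hxy) h₁ 2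
  have h₄ := pow_le_pow_left₀ ((sub_nonneg.2 hxy).trans h₁) h₂ 2
  apply sq_le_sq' <;> linarith

set_option maxHeartbeats 1000000 in
/-- The pairing and the determinant can be prescribed simultaneously: on the level curve of the
pairing through `t = 1`, the determinant is too large at `t = 1` and too small where the curve
meets `x = 1` or `x = -1`. -/
lemma exists_level_of_chamber {a₁ a₂ b₁ b₂ c₁ c₂ : ℝ} (hb₂ : 0 ≤ b₂) (hc₂ : 0 ≤ c₂)
    (hc : c₂ ≤ c₁) (ha : a₂ ≤ a₁) (h₁ : b₂ + c₂ < a₂) (h₂ : a₁ - a₂ + (c₁ - c₂) < b₁ - b₂)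
    (h₃ : a₂ ≤ b₂ + c₁) (h₄ : b₁ - b₂ ≤ c₁ + c₂ + (a₁ - a₂)) :
    ∃ x t : ℝ, x ∈ Set.Icc (-1) 1 ∧ t ∈ Set.Icc 0 1 ∧
      diagPairing a₁ a₂ b₁ b₂ x t = (c₁ ^ 2 + c₂ ^ 2 - a₁ ^ 2 - a₂ ^ 2 - b₁ ^ 2 - b₂ ^ 2) / 2 ∧
      detNormSq a₁ a₂ b₁ b₂ x t = (c₁ * c₂) ^ 2 := by
  obtain ⟨K, hK⟩ : ∃ K, K = (c₁ ^ 2 + c₂ ^ 2 - a₁ ^ 2 - a₂ ^ 2 - b₁ ^ 2 - b₂ ^ 2) / 2 := ⟨_, rfl⟩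
  rw [← hK]
  have ha₂ : 0 < a₂ := by linarith
  have ha₁ : 0 < a₁ := by linarith
  have hb₁ : 0 < b₁ := by linarith
  have hS : 0 < a₁ + a₂ := by linarith
  have hab : 0 < a₁ * b₁ := mul_pos ha₁ hb₁
  obtain ⟨x₀, hx₀⟩ : ∃ x₀, a₁ * b₁ * x₀ = -(K + a₂ * b₂) :=
    ⟨-(K + a₂ * b₂) / (a₁ * b₁), by field_simp⟩
  have hx₀_ge : -1 ≤ x₀ := by
    have : 0 ≤ a₁ * b₁ * (x₀ + 1) := by nlinarith
    nlinarith [nonneg_of_mul_nonneg_right this hab]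
  have hx₀_le : x₀ ≤ 1 := by
    have : 0 ≤ a₁ * b₁ * (1 - x₀) := by
      have : (b₁ - a₁) ^ 2 + (a₂ - b₂) ^ 2 ≤ c₁ ^ 2 + c₂ ^ 2 :=
        sq_add_sq_le_of_add_le (by linarith) hc₂ (by linarith) (by linarith) (by linarith)
          (by linarith) (by linarith)
      nlinarith
    nlinarith [nonneg_of_mul_nonneg_right this hab]
  have hend₀ : (c₁ * c₂) ^ 2 ≤ detNormSq a₁ a₂ b₁ b₂ x₀ 1 := by
    have : detNormSq a₁ a₂ b₁ b₂ x₀ 1 =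
        (a₂ - b₂) ^ 2 * (c₁ ^ 2 + c₂ ^ 2 - (a₂ - b₂) ^ 2) := by
      simp only [detNormSq]
      linear_combination (-2 * (a₂ - b₂) ^ 2) * hx₀ + 2 * (a₂ - b₂) ^ 2 * hK
    rw [this]
    have h6 : 0 ≤ c₁ ^ 2 - (a₂ - b₂) ^ 2 := by nlinarith
    have h7 : 0 ≤ (a₂ - b₂) ^ 2 - c₂ ^ 2 := by nlinarith
    nlinarith [mul_nonneg h6 h7]
  have hend₁ : ∀ t, (a₁ + a₂) * (b₁ + b₂) * t = a₂ * b₁ + a₁ * b₂ - K →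
      detNormSq a₁ a₂ b₁ b₂ 1 t ≤ (c₁ * c₂) ^ 2 := by
    intro t ht
    have : detNormSq a₁ a₂ b₁ b₂ 1 t =
        ((c₁ ^ 2 + c₂ ^ 2 - (b₁ - b₂ + a₂ - a₁) ^ 2) / 2) ^ 2 := by
      have : K + a₁ * a₂ + b₁ * b₂ + a₁ * b₁ + a₂ * b₂ - a₂ * b₁ - a₁ * b₂ =
        (c₁ ^ 2 + c₂ ^ 2 - (b₁ - b₂ + a₂ - a₁) ^ 2) / 2 := by rw [hK]; ring
      rw [← this]
      have h : (a₁ * a₂ + b₂ * (a₂ - (a₁ + a₂) * t)) + b₁ * (b₂ + a₁ - (a₁ + a₂) * t) =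
          K + a₁ * a₂ + b₁ * b₂ + a₁ * b₁ + a₂ * b₂ - a₂ * b₁ - a₁ * b₂ := by
        linear_combination -ht
      rw [← h]; simp only [detNormSq]; ring
    rw [this]
    exact half_sub_sq_sq_le hc (by linarith) (by linarith)
  have hcont : ∀ l r : ℝ, (∀ x ∈ Set.Icc l r, b₁ * x + b₂ ≠ 0) → ContinuousOn
      (fun x => detNormSq a₁ a₂ b₁ b₂ x
        ((a₂ * b₁ * x + a₁ * b₂ - K) / ((a₁ + a₂) * (b₁ * x + b₂)))) (Set.Icc l r) := by
    intro l r h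
    have : ContinuousOn (fun x => (a₂ * b₁ * x + a₁ * b₂ - K) / ((a₁ + a₂) * (b₁ * x + b₂)))
        (Set.Icc l r) := by
      apply ContinuousOn.div (by fun_prop) (by fun_prop)
      intro x hx
      exact mul_ne_zero hS.ne' (h x hx)
    simp only [detNormSq]
    fun_prop
  have hpair : ∀ x, b₁ * x + b₂ ≠ 0 → diagPairing a₁ a₂ b₁ b₂ x
      ((a₂ * b₁ * x + a₁ * b₂ - K) / ((a₁ + a₂) * (b₁ * x + b₂))) = K := by
    intro x hx
    have hS' := hS.ne'
    simp only [diagPairing]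
    field_simp
    ring
  have hquot₀ : b₁ * x₀ + b₂ ≠ 0 →
      (a₂ * b₁ * x₀ + a₁ * b₂ - K) / ((a₁ + a₂) * (b₁ * x₀ + b₂)) = 1 := by
    intro h
    rw [div_eq_one_iff_eq (mul_ne_zero hS.ne' h)]
    linear_combination -hx₀
  rcases lt_trichotomy K (b₂ * (a₁ - a₂)) with hlt | heq | hgt
  · have hpos : ∀ x, x₀ ≤ x → 0 < b₁ * x + b₂ := by
      intro x hx
      have h8 : 0 < a₁ * (b₁ * x₀ + b₂) := by nlinarith
      have h9 := pos_of_mul_pos_right h8 ha₁.le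
      nlinarith
    have hmem := intermediate_value_Icc' hx₀_le (hcont x₀ 1 fun x hx => (hpos x hx.1).ne')
    obtain ⟨x, hx, hxt⟩ := hmem (show (c₁ * c₂) ^ 2 ∈ _ from by
      refine ⟨hend₁ _ ?_, ?_⟩
      · have := (hpos 1 hx₀_le).ne'
        have hS' := hS.ne'
        field_simp
      · simpa only [hquot₀ (hpos x₀ le_rfl).ne'] using hend₀)
    have hd := mul_pos hS (hpos x hx.1)
    refine ⟨x, _, ⟨hx₀_ge.trans hx.1, hx.2⟩, ⟨div_nonneg ?_ hd.le, ?_⟩,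
      hpair x (hpos x hx.1).ne', hxt⟩
    · nlinarith [mul_pos ha₂ (hpos x hx.1)]
    · rw [div_le_one hd]
      nlinarith [mul_le_mul_of_nonneg_left hx.1 hab.le]
  · have hx₀' : b₁ * x₀ + b₂ = 0 := by
      have : a₁ * (b₁ * x₀ + b₂) = 0 := by rw [heq] at hx₀; linear_combination hx₀
      exact (mul_eq_zero.1 this).resolve_left ha₁.ne'
    set t₀ := a₂ / (a₁ + a₂) with ht₀
    have ht₀S : (a₁ + a₂) * t₀ = a₂ := by rw [ht₀]; field_simp
    have ht₀_nonneg : 0 ≤ t₀ := by positivity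
    have ht₀_le : t₀ ≤ 1 := by rw [ht₀, div_le_one hS]; linarith
    rcases le_total (detNormSq a₁ a₂ b₁ b₂ x₀ t₀) ((c₁ * c₂) ^ 2) with hle | hle
    · have hc' : ContinuousOn (fun t => detNormSq a₁ a₂ b₁ b₂ x₀ t) (Set.Icc t₀ 1) := by
        simp only [detNormSq]; fun_prop
      obtain ⟨t, ht, htt⟩ := intermediate_value_Icc ht₀_le hc' ⟨hle, hend₀⟩
      refine ⟨x₀, t, ⟨hx₀_ge, hx₀_le⟩, ⟨ht₀_nonneg.trans ht.1, ht.2⟩, ?_, htt⟩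
      simp only [diagPairing]
      linear_combination (-((a₁ + a₂) * t - a₂)) * hx₀' - heq
    · have hc' : ContinuousOn (fun x => detNormSq a₁ a₂ b₁ b₂ x t₀) (Set.Icc x₀ 1) := by
        simp only [detNormSq]; fun_prop
      obtain ⟨x, hx, hxt⟩ := intermediate_value_Icc' hx₀_le hc'
        ⟨hend₁ t₀ (by rw [heq]; linear_combination (b₁ + b₂) * ht₀S), hle⟩
      refine ⟨x, t₀, ⟨hx₀_ge.trans hx.1, hx.2⟩, ⟨ht₀_nonneg, ht₀_le⟩, ?_, hxt⟩
      simp only [diagPairing]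
      linear_combination (-b₁ * x - b₂) * ht₀S - heq
  · have hneg : ∀ x, x ≤ x₀ → b₁ * x + b₂ < 0 := by
      intro x hx
      have h8 : 0 < a₁ * -(b₁ * x₀ + b₂) := by nlinarith
      have h9 := pos_of_mul_pos_right h8 ha₁.le
      nlinarith
    have hlarge : b₁ + b₂ + a₁ - a₂ < c₁ + c₂ := by
      by_contra! h
      nlinarith
    have hendm : ∀ t, (a₁ + a₂) * (b₂ - b₁) * t = -a₂ * b₁ + a₁ * b₂ - K →
        detNormSq a₁ a₂ b₁ b₂ (-1) t ≤ (c₁ * c₂) ^ 2 := by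
      intro t ht
      have : detNormSq a₁ a₂ b₁ b₂ (-1) t =
          ((c₁ ^ 2 + c₂ ^ 2 - (b₁ + b₂ + a₁ - a₂) ^ 2) / 2) ^ 2 := by
        have : K + a₁ * a₂ - b₁ * b₂ - a₁ * b₁ + a₂ * b₂ + a₂ * b₁ - a₁ * b₂ =
          (c₁ ^ 2 + c₂ ^ 2 - (b₁ + b₂ + a₁ - a₂) ^ 2) / 2 := by rw [hK]; ring
        rw [← this]
        have h : (a₁ * a₂ + b₂ * (a₂ - (a₁ + a₂) * t)) - b₁ * (b₂ + a₁ - (a₁ + a₂) * t) =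
            K + a₁ * a₂ - b₁ * b₂ - a₁ * b₁ + a₂ * b₂ + a₂ * b₁ - a₁ * b₂ := by
          linear_combination -ht
        rw [← h]; simp only [detNormSq]; ring
      rw [this]
      exact half_sub_sq_sq_le hc (by linarith) (by linarith)
    have hmem := intermediate_value_Icc hx₀_ge (hcont (-1) x₀ fun x hx => (hneg x hx.2).ne)
    obtain ⟨x, hx, hxt⟩ := hmem (show (c₁ * c₂) ^ 2 ∈ _ from by
      refine ⟨hendm _ ?_, ?_⟩
      · have hb : b₂ - b₁ ≠ 0 := (by linarith [hneg (-1) hx₀_ge] : b₂ - b₁ < 0).ne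
        rw [show b₁ * -1 + b₂ = b₂ - b₁ by ring, mul_div_assoc',
          mul_div_cancel_left₀ _ (mul_ne_zero hS.ne' hb)]
        ring
      · simpa only [hquot₀ (hneg x₀ le_rfl).ne] using hend₀)
    have hd := mul_neg_of_pos_of_neg hS (hneg x hx.2)
    refine ⟨x, _, ⟨hx.1, hx.2.trans hx₀_le⟩, ⟨div_nonneg_of_nonpos ?_ hd.le, ?_⟩,
      hpair x (hneg x hx.2).ne, hxt⟩
    · nlinarith [mul_neg_of_pos_of_neg ha₂ (hneg x hx.2)]
    · rw [div_le_one_of_neg hd]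
      nlinarith [mul_le_mul_of_nonneg_left hx.2 hab.le]

/-- `x` and `y` are, up to order and sign, the singular values of the `2 × 2` matrix `M`. -/
def HasSingularValues (M : Matrix (Fin 2) (Fin 2) ℂ) (x y : ℝ) : Prop :=
  Complex.normSq (M 0 0) + Complex.normSq (M 0 1) + Complex.normSq (M 1 0) +
      Complex.normSq (M 1 1) = x ^ 2 + y ^ 2 ∧
    Complex.normSq (M 0 0 * M 1 1 - M 0 1 * M 1 0) = (x * y) ^ 2

/-- The three pairs of reals are singular values of `2 × 2` matrices with zero sum. -/
def Realizable (a₁ a₂ b₁ b₂ c₁ c₂ : ℝ) : Prop :=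
  ∃ A B C : Matrix (Fin 2) (Fin 2) ℂ, A + B + C = 0 ∧ HasSingularValues A a₁ a₂ ∧
    HasSingularValues B b₁ b₂ ∧ HasSingularValues C c₁ c₂

lemma Realizable.of_add {a₁ a₂ b₁ b₂ c₁ c₂ : ℝ} {A B : Matrix (Fin 2) (Fin 2) ℂ}
    (hA : HasSingularValues A a₁ a₂) (hB : HasSingularValues B b₁ b₂)
    (hC : HasSingularValues (A + B) c₁ c₂) : Realizable a₁ a₂ b₁ b₂ c₁ c₂ := by
  refine ⟨A, B, -(A + B), by simp, hA, hB, ?_⟩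
  simpa [HasSingularValues, -neg_add_rev] using hC

lemma Realizable.swap {a₁ a₂ b₁ b₂ c₁ c₂ : ℝ} (h : Realizable a₁ a₂ b₁ b₂ c₁ c₂) :
    Realizable b₁ b₂ a₁ a₂ c₁ c₂ := by
  obtain ⟨A, B, C, h, hA, hB, hC⟩ := h
  exact ⟨B, A, C, by rw [← h]; abel, hB, hA, hC⟩

lemma Realizable.rotate {a₁ a₂ b₁ b₂ c₁ c₂ : ℝ} (h : Realizable a₁ a₂ b₁ b₂ c₁ c₂) :
    Realizable b₁ b₂ c₁ c₂ a₁ a₂ := by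
  obtain ⟨A, B, C, h, hA, hB, hC⟩ := h
  exact ⟨B, C, A, by rw [← h]; abel, hB, hC, hA⟩

lemma exists_normSq_add_eq {x y z : ℝ} (hx : 0 ≤ x) (hy : 0 ≤ y) (hz : 0 ≤ z)
    (h₁ : x ≤ y + z) (h₂ : y ≤ x + z) (h₃ : z ≤ x + y) :
    ∃ w : ℂ, Complex.normSq w = y ^ 2 ∧ Complex.normSq (x + w) = z ^ 2 := by
  rcases hx.eq_or_lt with rfl | hx
  · obtain rfl : y = z := by linarith
    exact ⟨y, by simp [Complex.normSq_apply]; ring, by simp [Complex.normSq_apply]; ring⟩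
  · obtain ⟨r, hr⟩ : ∃ r, 2 * x * r = z ^ 2 - x ^ 2 - y ^ 2 :=
      ⟨(z ^ 2 - x ^ 2 - y ^ 2) / (2 * x), by field_simp⟩
    have hr₁ : 0 ≤ y - r := by
      have : 0 ≤ 2 * x * (y - r) := by nlinarith
      exact nonneg_of_mul_nonneg_right this (by linarith)
    have hr₂ : 0 ≤ y + r := by
      have : 0 ≤ 2 * x * (y + r) := by nlinarith
      exact nonneg_of_mul_nonneg_right this (by linarith)
    have hs := Real.mul_self_sqrt (by nlinarith : 0 ≤ y ^ 2 - r ^ 2)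
    refine ⟨⟨r, Real.sqrt (y ^ 2 - r ^ 2)⟩, ?_, ?_⟩
    · simp only [Complex.normSq_mk]
      linear_combination hs
    · simp only [Complex.normSq_apply, Complex.add_re, Complex.add_im, Complex.ofReal_re,
        Complex.ofReal_im]
      linear_combination hs + hr

lemma realizable_of_triangle {a₁ a₂ b₁ b₂ c₁ c₂ : ℝ} (ha₁ : 0 ≤ a₁) (ha₂ : 0 ≤ a₂) (hb₁ : 0 ≤ b₁)
    (hb₂ : 0 ≤ b₂) (hc₁ : 0 ≤ c₁) (hc₂ : 0 ≤ c₂) (h₁ : a₁ ≤ b₁ + c₁) (h₂ : b₁ ≤ a₁ + c₁)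
    (h₃ : c₁ ≤ a₁ + b₁) (h₄ : a₂ ≤ b₂ + c₂) (h₅ : b₂ ≤ a₂ + c₂) (h₆ : c₂ ≤ a₂ + b₂) :
    Realizable a₁ a₂ b₁ b₂ c₁ c₂ := by
  obtain ⟨w, hw, hw'⟩ := exists_normSq_add_eq ha₁ hb₁ hc₁ h₁ h₂ h₃
  obtain ⟨v, hv, hv'⟩ := exists_normSq_add_eq ha₂ hb₂ hc₂ h₄ h₅ h₆
  refine Realizable.of_add (A := !![(a₁ : ℂ), 0; 0, (a₂ : ℂ)]) (B := !![w, 0; 0, v]) ?_ ?_ ?_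
  · simp [HasSingularValues, Complex.normSq_ofReal]; constructor <;> ring
  · simp [HasSingularValues, hw, hv]; ring
  · simp [HasSingularValues, hw', hv']; ring

/-- The sum of the similarity with matrix `p` and the anti-similarity with matrix `q`. -/
def conformalSum (p q : ℂ) : Matrix (Fin 2) (Fin 2) ℂ :=
  !![((p.re + q.re : ℝ) : ℂ), ((q.im - p.im : ℝ) : ℂ);
    ((p.im + q.im : ℝ) : ℂ), ((p.re - q.re : ℝ) : ℂ)]

lemma hasSingularValues_conformalSum {p q : ℂ} {s d : ℝ} (hp : Complex.normSq p = s ^ 2)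
    (hq : Complex.normSq q = d ^ 2) : HasSingularValues (conformalSum p q) (s + d) (s - d) := by
  rw [Complex.normSq_apply] at hp hq
  constructor
  · simp only [conformalSum, Complex.normSq_ofReal, of_apply, cons_val', cons_val_zero,
      cons_val_one, cons_val_fin_one]
    linear_combination 2 * hp + 2 * hq
  · simp only [conformalSum, of_apply, cons_val', cons_val_zero, cons_val_one, cons_val_fin_one,
      ← Complex.ofReal_mul, ← Complex.ofReal_sub, Complex.normSq_ofReal]
    have : (p.re + q.re) * (p.re - q.re) - (q.im - p.im) * (p.im + q.im) = (s + d) * (s - d) := by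
      linear_combination hp - hq
    rw [this]; ring

lemma realizable_of_half_sum_triangle {a₁ a₂ b₁ b₂ c₁ c₂ : ℝ} (ha : a₂ ≤ a₁) (ha₂ : 0 ≤ a₂)
    (hb : b₂ ≤ b₁) (hb₂ : 0 ≤ b₂) (hc : c₂ ≤ c₁) (hc₂ : 0 ≤ c₂)
    (h₁ : a₁ + a₂ ≤ b₁ + b₂ + (c₁ + c₂)) (h₂ : b₁ + b₂ ≤ a₁ + a₂ + (c₁ + c₂))
    (h₃ : c₁ + c₂ ≤ a₁ + a₂ + (b₁ + b₂)) (h₄ : a₁ - a₂ ≤ b₁ - b₂ + (c₁ - c₂))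
    (h₅ : b₁ - b₂ ≤ a₁ - a₂ + (c₁ - c₂)) (h₆ : c₁ - c₂ ≤ a₁ - a₂ + (b₁ - b₂)) :
    Realizable a₁ a₂ b₁ b₂ c₁ c₂ := by
  obtain ⟨w, hw, hw'⟩ := exists_normSq_add_eq (x := (a₁ + a₂) / 2) (y := (b₁ + b₂) / 2)
    (z := (c₁ + c₂) / 2) (by linarith) (by linarith) (by linarith) (by linarith) (by linarith)
    (by linarith)
  obtain ⟨v, hv, hv'⟩ := exists_normSq_add_eq (x := (a₁ - a₂) / 2) (y := (b₁ - b₂) / 2)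
    (z := (c₁ - c₂) / 2) (by linarith) (by linarith) (by linarith) (by linarith) (by linarith)
    (by linarith)
  have key : ∀ {p q : ℂ} {x y : ℝ}, Complex.normSq p = ((x + y) / 2) ^ 2 →
      Complex.normSq q = ((x - y) / 2) ^ 2 → HasSingularValues (conformalSum p q) x y := by
    intro p q x y hp hq
    convert hasSingularValues_conformalSum hp hq using 1 <;> ring
  refine Realizable.of_add (A := conformalSum ((a₁ + a₂) / 2 : ℝ) ((a₁ - a₂) / 2 : ℝ))
    (B := conformalSum w v) (key ?_ ?_) (key hw hv) ?_
  · rw [Complex.normSq_ofReal]; ring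
  · rw [Complex.normSq_ofReal]; ring
  · convert key hw' hv' using 1
    ext i j
    fin_cases i <;> fin_cases j <;> simp [conformalSum] <;> ring

/-- `-R * diag(b₁ z, b₂) * R` for the rotation `R` with cosine `c` and sine `s`. -/
def rotatedDiag (b₁ b₂ : ℝ) (z : ℂ) (c s : ℝ) : Matrix (Fin 2) (Fin 2) ℂ :=
  !![-(c ^ 2 * (b₁ * z) - s ^ 2 * b₂), c * s * (b₁ * z + b₂);
    -(c * s * (b₁ * z + b₂)), -(c ^ 2 * b₂ - s ^ 2 * (b₁ * z))]

lemma hasSingularValues_rotatedDiag (b₁ b₂ : ℝ) {x y c s : ℝ} (hz : x ^ 2 + y ^ 2 = 1)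
    (hcs : c ^ 2 + s ^ 2 = 1) : HasSingularValues (rotatedDiag b₁ b₂ ⟨x, y⟩ c s) b₁ b₂ := by
  constructor
  · simp [rotatedDiag, Complex.normSq_apply, pow_two]
    have h : (c ^ 2 + s ^ 2) ^ 2 * (b₁ ^ 2 * (x ^ 2 + y ^ 2) + b₂ ^ 2) = b₁ ^ 2 + b₂ ^ 2 := by
      rw [hz, hcs]; ring
    linear_combination h
  · have h : -(c ^ 2 * (b₁ * (⟨x, y⟩ : ℂ)) - s ^ 2 * b₂) * -(c ^ 2 * b₂ - s ^ 2 * (b₁ * ⟨x, y⟩)) -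
        c * s * (b₁ * ⟨x, y⟩ + b₂) * -(c * s * (b₁ * ⟨x, y⟩ + b₂)) = b₁ * b₂ * ⟨x, y⟩ := by
      have : (c : ℂ) ^ 2 + (s : ℂ) ^ 2 = 1 := by exact_mod_cast hcs
      linear_combination (b₁ * b₂ * ⟨x, y⟩ * ((c : ℂ) ^ 2 + (s : ℂ) ^ 2 + 1)) * this
    simp only [rotatedDiag, of_apply, cons_val', cons_val_zero, cons_val_one, cons_val_fin_one, h,
      map_mul, Complex.normSq_ofReal, Complex.normSq_mk]
    linear_combination (b₁ * b₂) ^ 2 * hz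

lemma hasSingularValues_diag_add_rotatedDiag {a₁ a₂ b₁ b₂ c₁ c₂ x y c s : ℝ}
    (hz : x ^ 2 + y ^ 2 = 1) (hcs : c ^ 2 + s ^ 2 = 1)
    (h₁ : diagPairing a₁ a₂ b₁ b₂ x (c ^ 2) =
      (c₁ ^ 2 + c₂ ^ 2 - a₁ ^ 2 - a₂ ^ 2 - b₁ ^ 2 - b₂ ^ 2) / 2)
    (h₂ : detNormSq a₁ a₂ b₁ b₂ x (c ^ 2) = (c₁ * c₂) ^ 2) :
    HasSingularValues (!![(a₁ : ℂ), 0; 0, (a₂ : ℂ)] + rotatedDiag b₁ b₂ ⟨x, y⟩ c s) c₁ c₂ := by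
  have hs : s ^ 2 = 1 - c ^ 2 := by linarith
  have hsC : (s : ℂ) ^ 2 = 1 - (c : ℂ) ^ 2 := by exact_mod_cast hs
  constructor
  · have hB := (hasSingularValues_rotatedDiag b₁ b₂ hz hcs).1
    simp [rotatedDiag, Complex.normSq_apply, pow_two] at hB ⊢
    simp only [diagPairing] at h₁
    linear_combination hB + 2 * h₁ + 2 * (a₁ * b₂ + a₂ * b₁ * x) * hs
  · rw [← h₂]
    have h : (a₁ + -(c ^ 2 * (b₁ * (⟨x, y⟩ : ℂ)) - s ^ 2 * b₂)) *
        (a₂ + -(c ^ 2 * b₂ - s ^ 2 * (b₁ * ⟨x, y⟩))) -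
        c * s * (b₁ * ⟨x, y⟩ + b₂) * -(c * s * (b₁ * ⟨x, y⟩ + b₂)) =
        ((a₁ * a₂ + b₂ * (a₂ - (a₁ + a₂) * c ^ 2) : ℝ) : ℂ) +
          ((b₁ * (b₂ + a₁ - (a₁ + a₂) * c ^ 2) : ℝ) : ℂ) * ⟨x, y⟩ := by
      push_cast
      have e : (c * s * (b₁ * (⟨x, y⟩ : ℂ) + b₂) * -(c * s * (b₁ * ⟨x, y⟩ + b₂)) : ℂ) =
        - ((c : ℂ) ^ 2 * (s : ℂ) ^ 2 * (b₁ * (⟨x, y⟩ : ℂ) + b₂) ^ 2) := by ring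
      rw [e, hsC]
      ring
    have hd : ∀ p q : ℝ, Complex.normSq (p + q * (⟨x, y⟩ : ℂ)) = p ^ 2 + q ^ 2 + 2 * p * q * x := by
      intro p q
      simp [Complex.normSq_apply]
      linear_combination q ^ 2 * hz
    simp only [rotatedDiag, Matrix.add_apply, of_apply, cons_val', cons_val_zero, cons_val_one,
      cons_val_fin_one, zero_add, h, hd, detNormSq]

lemma realizable_of_chamber {a₁ a₂ b₁ b₂ c₁ c₂ : ℝ} (hb₂ : 0 ≤ b₂) (hc₂ : 0 ≤ c₂)
    (hc : c₂ ≤ c₁) (ha : a₂ ≤ a₁) (h₁ : b₂ + c₂ < a₂) (h₂ : a₁ - a₂ + (c₁ - c₂) < b₁ - b₂)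
    (h₃ : a₂ ≤ b₂ + c₁) (h₄ : b₁ - b₂ ≤ c₁ + c₂ + (a₁ - a₂)) :
    Realizable a₁ a₂ b₁ b₂ c₁ c₂ := by
  obtain ⟨x, t, hx, ht, hxt, hxt'⟩ := exists_level_of_chamber hb₂ hc₂ hc ha h₁ h₂ h₃ h₄
  have hz : x ^ 2 + Real.sqrt (1 - x ^ 2) ^ 2 = 1 := by
    rw [Real.sq_sqrt (by nlinarith [hx.1, hx.2])]; ring
  have ht' := Real.sq_sqrt ht.1
  have hcs : Real.sqrt t ^ 2 + Real.sqrt (1 - t) ^ 2 = 1 := by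
    rw [ht', Real.sq_sqrt (by linarith [ht.2])]; ring
  refine Realizable.of_add (A := !![(a₁ : ℂ), 0; 0, (a₂ : ℂ)]) ?_
    (hasSingularValues_rotatedDiag b₁ b₂ hz hcs)
    (hasSingularValues_diag_add_rotatedDiag hz hcs (by rwa [ht']) (by rwa [ht']))
  simp [HasSingularValues, Complex.normSq_ofReal]; constructor <;> ring

lemma realizable_of_inequalities {a₁ a₂ b₁ b₂ c₁ c₂ : ℝ} (ha : a₂ ≤ a₁) (ha₂ : 0 ≤ a₂)
    (hb : b₂ ≤ b₁) (hb₂ : 0 ≤ b₂) (hc : c₂ ≤ c₁) (hc₂ : 0 ≤ c₂)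
    (w₁ : a₁ ≤ b₁ + c₁) (w₂ : b₁ ≤ a₁ + c₁) (w₃ : c₁ ≤ a₁ + b₁)
    (v₁ : a₂ ≤ b₁ + c₂) (v₂ : a₂ ≤ c₁ + b₂) (v₃ : b₂ ≤ a₁ + c₂) (v₄ : b₂ ≤ c₁ + a₂)
    (v₅ : c₂ ≤ a₁ + b₂) (v₆ : c₂ ≤ b₁ + a₂)
    (l₁ : a₁ + a₂ ≤ b₁ + b₂ + (c₁ + c₂)) (l₂ : b₁ + b₂ ≤ a₁ + a₂ + (c₁ + c₂))
    (l₃ : c₁ + c₂ ≤ a₁ + a₂ + (b₁ + b₂))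
    (s₁ : a₁ - a₂ ≤ b₁ + b₂ + (c₁ - c₂)) (s₂ : a₁ - a₂ ≤ c₁ + c₂ + (b₁ - b₂))
    (s₃ : b₁ - b₂ ≤ a₁ + a₂ + (c₁ - c₂)) (s₄ : b₁ - b₂ ≤ c₁ + c₂ + (a₁ - a₂))
    (s₅ : c₁ - c₂ ≤ a₁ + a₂ + (b₁ - b₂)) (s₆ : c₁ - c₂ ≤ b₁ + b₂ + (a₁ - a₂)) :
    Realizable a₁ a₂ b₁ b₂ c₁ c₂ := by
  by_cases ht : a₂ ≤ b₂ + c₂ ∧ b₂ ≤ a₂ + c₂ ∧ c₂ ≤ a₂ + b₂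
  · exact realizable_of_triangle (ha₂.trans ha) ha₂ (hb₂.trans hb) hb₂ (hc₂.trans hc) hc₂ w₁ w₂ w₃
      ht.1 ht.2.1 ht.2.2
  by_cases hd : a₁ - a₂ ≤ b₁ - b₂ + (c₁ - c₂) ∧ b₁ - b₂ ≤ a₁ - a₂ + (c₁ - c₂) ∧
      c₁ - c₂ ≤ a₁ - a₂ + (b₁ - b₂)
  · exact realizable_of_half_sum_triangle ha ha₂ hb hb₂ hc hc₂ l₁ l₂ l₃ hd.1 hd.2.1 hd.2.2
  have ht' : b₂ + c₂ < a₂ ∨ a₂ + c₂ < b₂ ∨ a₂ + b₂ < c₂ := by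
    by_contra! h; exact ht ⟨h.1, h.2.1, h.2.2⟩
  have hd' : b₁ - b₂ + (c₁ - c₂) < a₁ - a₂ ∨ a₁ - a₂ + (c₁ - c₂) < b₁ - b₂ ∨
      a₁ - a₂ + (b₁ - b₂) < c₁ - c₂ := by
    by_contra! h; exact hd ⟨h.1, h.2.1, h.2.2⟩
  rcases ht' with h | h | h <;> rcases hd' with h' | h' | h'
  · linarith
  · exact realizable_of_chamber hb₂ hc₂ hc ha h h' (by linarith) s₄
  · exact (realizable_of_chamber (a₁ := a₁) (b₁ := c₁) (c₁ := b₁) hc₂ hb₂ hb ha (by linarith) h'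
      (by linarith) s₆).rotate.rotate.swap
  · exact (realizable_of_chamber (a₁ := b₁) (b₁ := a₁) (c₁ := c₁) ha₂ hc₂ hc hb h (by linarith)
      (by linarith) s₂).swap
  · linarith
  · exact (realizable_of_chamber (a₁ := b₁) (b₁ := c₁) (c₁ := a₁) hc₂ ha₂ ha hb (by linarith)
      (by linarith) (by linarith) s₅).rotate.rotate
  · exact (realizable_of_chamber (a₁ := c₁) (b₁ := a₁) (c₁ := b₁) ha₂ hb₂ hb hc (by linarith)
      (by linarith) (by linarith) s₁).rotate
  · exact (realizable_of_chamber (a₁ := c₁) (b₁ := b₁) (c₁ := a₁) hb₂ ha₂ ha hc (by linarith)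
      (by linarith) (by linarith) s₃).rotate.swap
  · linarith

/-- The squared length of the `j`-th column. -/
noncomputable def colNormSq {p : ℕ} (M : Matrix (Fin p) (Fin 2) ℂ) (j : Fin 2) : ℝ :=
  ∑ i, Complex.normSq (M i j)

/-- The Hermitian inner product of the two columns. -/
noncomputable def colInner {p : ℕ} (M : Matrix (Fin p) (Fin 2) ℂ) : ℂ :=
  ∑ i, starRingEnd ℂ (M i 0) * M i 1

lemma conjTranspose_mul_self_apply_self {p : ℕ} (M : Matrix (Fin p) (Fin 2) ℂ) (j : Fin 2) :
    (Mᴴ * M) j j = colNormSq M j := by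
  simp only [mul_apply, conjTranspose_apply, colNormSq, RCLike.star_def, Complex.ofReal_sum,
    Complex.normSq_eq_conj_mul_self]

lemma det_conjTranspose_mul_self {p : ℕ} (M : Matrix (Fin p) (Fin 2) ℂ) :
    (Mᴴ * M).det =
      ((colNormSq M 0 * colNormSq M 1 - Complex.normSq (colInner M) : ℝ) : ℂ) := by
  have h₁ : (Mᴴ * M) 0 1 = colInner M := by
    simp [mul_apply, conjTranspose_apply, colInner]
  have h₂ : (Mᴴ * M) 1 0 = starRingEnd ℂ (colInner M) := by
    simp [mul_apply, conjTranspose_apply, colInner, mul_comm]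
  rw [det_fin_two, conjTranspose_mul_self_apply_self, conjTranspose_mul_self_apply_self, h₁, h₂,
    Complex.mul_conj]
  push_cast
  ring

lemma eigsDesc_sum_and_prod {H : Matrix (Fin 2) (Fin 2) ℂ} (hH : H.IsHermitian) :
    eigsDesc hH 1 ≤ eigsDesc hH 0 ∧ ((eigsDesc hH 0 + eigsDesc hH 1 : ℝ) : ℂ) = H.trace ∧
      ((eigsDesc hH 0 * eigsDesc hH 1 : ℝ) : ℂ) = H.det := by
  have h₀ : eigsDesc hH 0 = hH.eigenvalues (Tuple.sort hH.eigenvalues 1) := rfl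
  have h₁ : eigsDesc hH 1 = hH.eigenvalues (Tuple.sort hH.eigenvalues 0) := rfl
  rw [h₀, h₁]
  refine ⟨Tuple.monotone_sort hH.eigenvalues (Fin.zero_le 1), ?_, ?_⟩
  · rw [hH.trace_eq_sum_eigenvalues,
      ← Equiv.sum_comp (Tuple.sort hH.eigenvalues), Fin.sum_univ_two, add_comm]
    simp
  · rw [hH.det_eq_prod_eigenvalues,
      ← Equiv.prod_comp (Tuple.sort hH.eigenvalues), Fin.prod_univ_two, mul_comm]
    simp

open scoped ComplexOrder in
lemma singularValues_spec {p : ℕ} (M : Matrix (Fin p) (Fin 2) ℂ) :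
    0 ≤ singularValues M 1 ∧ singularValues M 1 ≤ singularValues M 0 ∧
      singularValues M 0 ^ 2 + singularValues M 1 ^ 2 = colNormSq M 0 + colNormSq M 1 ∧
      (singularValues M 0 * singularValues M 1) ^ 2 =
        colNormSq M 0 * colNormSq M 1 - Complex.normSq (colInner M) := by
  have hH := isHermitian_conjTranspose_mul_self M
  obtain ⟨hle, hsum, hprod⟩ := eigsDesc_sum_and_prod hH
  have hnn : ∀ i, 0 ≤ eigsDesc hH i := fun i =>
    (posSemidef_conjTranspose_mul_self M).eigenvalues_nonneg _
  rw [trace_fin_two, conjTranspose_mul_self_apply_self, conjTranspose_mul_self_apply_self,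
    ← Complex.ofReal_add, Complex.ofReal_inj] at hsum
  rw [det_conjTranspose_mul_self, Complex.ofReal_inj] at hprod
  simp only [singularValues]
  refine ⟨Real.sqrt_nonneg _, Real.sqrt_le_sqrt hle, ?_, ?_⟩
  · rw [Real.sq_sqrt (hnn 0), Real.sq_sqrt (hnn 1), hsum]
  · rw [mul_pow, Real.sq_sqrt (hnn 0), Real.sq_sqrt (hnn 1), hprod]

lemma eq_of_sq_add_sq_eq {x y u v : ℝ} (hy : 0 ≤ y) (hxy : y ≤ x) (hv : 0 ≤ v) (huv : v ≤ u)
    (h₁ : x ^ 2 + y ^ 2 = u ^ 2 + v ^ 2) (h₂ : (x * y) ^ 2 = (u * v) ^ 2) : x = u ∧ y = v := by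
  have h₃ : x * y = u * v :=
    (sq_eq_sq₀ (mul_nonneg (hy.trans hxy) hy) (mul_nonneg (hv.trans huv) hv)).1 h₂
  have h₄ : x + y = u + v := (sq_eq_sq₀ (by linarith) (by linarith)).1 (by linarith)
  have h₅ : x - y = u - v := (sq_eq_sq₀ (by linarith) (by linarith)).1 (by linarith)
  constructor <;> linarith

lemma singularValues_eq {p : ℕ} {M : Matrix (Fin p) (Fin 2) ℂ} {a : Fin 2 → ℝ}
    (ha : a 1 ≤ a 0 ∧ 0 ≤ a 1) (h₁ : colNormSq M 0 + colNormSq M 1 = a 0 ^ 2 + a 1 ^ 2)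
    (h₂ : colNormSq M 0 * colNormSq M 1 - Complex.normSq (colInner M) = (a 0 * a 1) ^ 2) :
    singularValues M = a := by
  obtain ⟨hn, hle, hs, hp⟩ := singularValues_spec M
  obtain ⟨h₃, h₄⟩ := eq_of_sq_add_sq_eq hn hle ha.2 ha.1 (hs.trans h₁) (hp.trans h₂)
  ext i
  fin_cases i
  · exact h₃
  · exact h₄

lemma singularValues_isometry_mul {p : ℕ} {E : Matrix (Fin p) (Fin 2) ℂ} (hE : Eᴴ * E = 1)
    (M : Matrix (Fin 2) (Fin 2) ℂ) : singularValues (E * M) = singularValues M := by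
  have h : (E * M)ᴴ * (E * M) = Mᴴ * M := by
    rw [conjTranspose_mul, Matrix.mul_assoc, ← Matrix.mul_assoc Eᴴ, hE, Matrix.one_mul]
  have : ∀ {H K : Matrix (Fin 2) (Fin 2) ℂ} (hH : H.IsHermitian) (hK : K.IsHermitian), H = K →
      eigsDesc hH = eigsDesc hK := by
    rintro H K hH hK rfl
    rfl
  funext i
  simp only [singularValues]
  rw [this _ (isHermitian_conjTranspose_mul_self M) h]

lemma exists_isometry {p : ℕ} (hp : 2 ≤ p) :
    ∃ E : Matrix (Fin p) (Fin 2) ℂ, Eᴴ * E = 1 := by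
  refine ⟨(1 : Matrix (Fin p) (Fin p) ℂ).submatrix id (Fin.castLE hp), ?_⟩
  rw [conjTranspose_submatrix, ← submatrix_mul _ _ _ _ _ Function.bijective_id,
    conjTranspose_one, Matrix.one_mul, submatrix_one _ (Fin.castLE_injective hp)]

lemma HasSingularValues.singularValues_eq {M : Matrix (Fin 2) (Fin 2) ℂ} {a : Fin 2 → ℝ}
    (ha : a 1 ≤ a 0 ∧ 0 ≤ a 1) (h : HasSingularValues M (a 0) (a 1)) :
    singularValues M = a := by
  obtain ⟨h₁, h₂⟩ := h
  apply _root_.singularValues_eq ha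
  · rw [← h₁]
    simp only [colNormSq, Fin.sum_univ_two]
    ring
  · rw [← h₂]
    simp only [colNormSq, colInner, Fin.sum_univ_two]
    simp [Complex.normSq_apply]
    ring

lemma mem_singularCone_of_realizable {p : ℕ} (hp : 2 ≤ p) {a b c : Fin 2 → ℝ}
    (ha : a 1 ≤ a 0 ∧ 0 ≤ a 1) (hb : b 1 ≤ b 0 ∧ 0 ≤ b 1) (hc : c 1 ≤ c 0 ∧ 0 ≤ c 1)
    (h : Realizable (a 0) (a 1) (b 0) (b 1) (c 0) (c 1)) : (a, b, c) ∈ SingularCone p 2 := by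
  obtain ⟨A, B, C, hABC, hA, hB, hC⟩ := h
  obtain ⟨E, hE⟩ := exists_isometry hp
  refine ⟨E * A, E * B, E * C, ?_, ?_, ?_, ?_⟩
  · rw [← Matrix.mul_add, ← Matrix.mul_add, hABC, Matrix.mul_zero]
  · exact (singularValues_isometry_mul hE A).trans (hA.singularValues_eq ha)
  · exact (singularValues_isometry_mul hE B).trans (hB.singularValues_eq hb)
  · exact (singularValues_isometry_mul hE C).trans (hC.singularValues_eq hc)

lemma le_of_sq_le_sq_of_nonneg {x y : ℝ} (h : x ^ 2 ≤ y ^ 2) (hy : 0 ≤ y) : x ≤ y :=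
  (abs_le_of_sq_le_sq' h hy).2

/-- The `2 × 2` minor of `M` on the rows `k.1` and `k.2`. -/
def rowMinor {p : ℕ} (M : Matrix (Fin p) (Fin 2) ℂ) (k : Fin p × Fin p) : ℂ :=
  M k.1 0 * M k.2 1 - M k.2 0 * M k.1 1

lemma sum_normSq_rowMinor {p : ℕ} (M : Matrix (Fin p) (Fin 2) ℂ) :
    ∑ k, Complex.normSq (rowMinor M k) =
      2 * (singularValues M 0 * singularValues M 1) ^ 2 := by
  rw [(singularValues_spec M).2.2.2, Fintype.sum_prod_type]
  have h : ∀ i j, Complex.normSq (rowMinor M (i, j)) =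
      Complex.normSq (M i 0) * Complex.normSq (M j 1) +
        Complex.normSq (M i 1) * Complex.normSq (M j 0) -
        2 * ((starRingEnd ℂ (M i 0) * M i 1).re * (starRingEnd ℂ (M j 0) * M j 1).re +
          (starRingEnd ℂ (M i 0) * M i 1).im * (starRingEnd ℂ (M j 0) * M j 1).im) := by
    intro i j
    simp [rowMinor, Complex.normSq_apply]
    ring
  simp only [h, Finset.sum_add_distrib, Finset.sum_sub_distrib, ← Finset.mul_sum,
    ← Finset.sum_mul]
  simp only [colNormSq, colInner, Complex.normSq_apply (∑ i, _), Complex.re_sum, Complex.im_sum]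
  ring

/-- A quadratic form dominated by the singular values, see `minorForm_le`. -/
noncomputable def minorForm {p : ℕ} (ω : Fin p × Fin p → ℂ) (M : Matrix (Fin p) (Fin 2) ℂ) : ℝ :=
  colNormSq M 0 + colNormSq M 1 - ∑ k, (ω k * rowMinor M k).re

lemma minorForm_neg_right {p : ℕ} (ω : Fin p × Fin p → ℂ) (M : Matrix (Fin p) (Fin 2) ℂ) :
    minorForm ω (-M) = minorForm ω M := by
  simp [minorForm, colNormSq, rowMinor]

lemma sum_eq_quadratic {ι : Type*} [Fintype ι] {f a b c : ι → ℝ} {t : ℝ}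
    (h : ∀ k, f k = a k + t * (b k - a k - c k) + t ^ 2 * c k) :
    ∑ k, f k = ∑ k, a k + t * (∑ k, b k - ∑ k, a k - ∑ k, c k) + t ^ 2 * ∑ k, c k := by
  simp only [h, Finset.sum_add_distrib, Finset.sum_sub_distrib, ← Finset.mul_sum]

lemma minorForm_add_smul {p : ℕ} (ω : Fin p × Fin p → ℂ) (X Y : Matrix (Fin p) (Fin 2) ℂ)
    (t : ℝ) : minorForm ω (X + (t : ℂ) • Y) = minorForm ω X +
      t * (minorForm ω (X + Y) - minorForm ω X - minorForm ω Y) + t ^ 2 * minorForm ω Y := by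
  have h₁ : ∀ j, colNormSq (X + (t : ℂ) • Y) j = colNormSq X j +
      t * (colNormSq (X + Y) j - colNormSq X j - colNormSq Y j) + t ^ 2 * colNormSq Y j := by
    intro j
    apply sum_eq_quadratic
    intro i
    simp [Complex.normSq_apply]
    ring
  have h₂ : ∑ k, (ω k * rowMinor (X + (t : ℂ) • Y) k).re = ∑ k, (ω k * rowMinor X k).re +
      t * (∑ k, (ω k * rowMinor (X + Y) k).re - ∑ k, (ω k * rowMinor X k).re -
        ∑ k, (ω k * rowMinor Y k).re) + t ^ 2 * ∑ k, (ω k * rowMinor Y k).re := by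
    apply sum_eq_quadratic
    intro k
    simp [rowMinor]
    ring
  simp only [minorForm, h₁, h₂]
  ring

/-- The linear functional on minors given by `ω` is bounded by twice the product of the singular
values. -/
def IsMinorBound {p : ℕ} (ω : Fin p × Fin p → ℂ) : Prop :=
  ∀ M : Matrix (Fin p) (Fin 2) ℂ,
    |∑ k, (ω k * rowMinor M k).re| ≤ 2 * (singularValues M 0 * singularValues M 1)

lemma IsMinorBound.neg {p : ℕ} {ω : Fin p × Fin p → ℂ} (h : IsMinorBound ω) :
    IsMinorBound (-ω) := by
  intro M
  simpa only [Pi.neg_apply, neg_mul, Complex.neg_re, Finset.sum_neg_distrib, abs_neg] using h M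

lemma exists_isMinorBound_eq {p : ℕ} (Y : Matrix (Fin p) (Fin 2) ℂ) :
    ∃ ω, IsMinorBound ω ∧
      ∑ k, (ω k * rowMinor Y k).re = 2 * (singularValues Y 0 * singularValues Y 1) := by
  set D := singularValues Y 0 * singularValues Y 1 with hD
  have hY : ∑ k, Complex.normSq (rowMinor Y k) = 2 * D ^ 2 := sum_normSq_rowMinor Y
  refine ⟨fun k => (D⁻¹ : ℝ) * starRingEnd ℂ (rowMinor Y k), ?_, ?_⟩
  · intro M
    have hM := singularValues_spec M
    have hM₀ : 0 ≤ singularValues M 0 * singularValues M 1 :=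
      mul_nonneg (hM.1.trans hM.2.1) hM.1
    have hsum : ∑ k, ‖((D⁻¹ : ℝ) : ℂ) * starRingEnd ℂ (rowMinor Y k)‖ ^ 2 ≤ 2 := by
      simp only [← Complex.normSq_eq_norm_sq, map_mul, Complex.normSq_conj, Complex.normSq_ofReal,
        ← Finset.mul_sum, hY]
      rcases eq_or_ne D 0 with h | h
      · simp [h]
      · field_simp
        exact le_rfl
    have hcs := Finset.sum_mul_sq_le_sq_mul_sq Finset.univ
      (fun k => ‖((D⁻¹ : ℝ) : ℂ) * starRingEnd ℂ (rowMinor Y k)‖) (fun k => ‖rowMinor M k‖)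
    have hmin : ∑ k, ‖rowMinor M k‖ ^ 2 = 2 * (singularValues M 0 * singularValues M 1) ^ 2 := by
      simpa only [← Complex.normSq_eq_norm_sq] using sum_normSq_rowMinor M
    rw [hmin] at hcs
    refine (Finset.abs_sum_le_sum_abs _ _).trans ((Finset.sum_le_sum fun k _ =>
      (Complex.abs_re_le_norm _).trans (norm_mul_le _ _)).trans ?_)
    refine le_of_sq_le_sq_of_nonneg ?_ (by positivity)
    nlinarith [sq_nonneg (singularValues M 0 * singularValues M 1)]
  · have : ∀ k, (((D⁻¹ : ℝ) : ℂ) * starRingEnd ℂ (rowMinor Y k) * rowMinor Y k).re =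
        D⁻¹ * Complex.normSq (rowMinor Y k) := by
      intro k
      rw [mul_assoc, ← Complex.normSq_eq_conj_mul_self, ← Complex.ofReal_mul, Complex.ofReal_re]
    simp only [this, ← Finset.mul_sum, hY]
    rcases eq_or_ne D 0 with h | h
    · simp [h]
    · field_simp

lemma minorForm_nonneg {p : ℕ} {ω : Fin p × Fin p → ℂ} (h : IsMinorBound ω)
    (M : Matrix (Fin p) (Fin 2) ℂ) :
    (singularValues M 0 - singularValues M 1) ^ 2 ≤ minorForm ω M := by
  have := abs_le.1 (h M)
  rw [minorForm, ← (singularValues_spec M).2.2.1]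
  linarith [this.2]

lemma minorForm_le {p : ℕ} {ω : Fin p × Fin p → ℂ} (h : IsMinorBound ω)
    (M : Matrix (Fin p) (Fin 2) ℂ) :
    minorForm ω M ≤ (singularValues M 0 + singularValues M 1) ^ 2 := by
  have := abs_le.1 (h M)
  rw [minorForm, ← (singularValues_spec M).2.2.1]
  linarith [this.1]

lemma le_add_sq_of_quadratic_nonneg {q₁ q₂ q u v : ℝ} (hu : 0 ≤ u) (hv : 0 ≤ v) (h₁ : q₁ ≤ u ^ 2)
    (h₂ : q₂ ≤ v ^ 2) (hq₁ : 0 ≤ q₁)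
    (h : ∀ t : ℝ, 0 ≤ q₁ + t * (q - q₁ - q₂) + t ^ 2 * q₂) : q ≤ (u + v) ^ 2 := by
  have hd := discrim_le_zero (a := q₂) (b := q - q₁ - q₂) (c := q₁)
    (fun t => by linarith [h t, show q₂ * (t * t) = t ^ 2 * q₂ by ring])
  rw [discrim] at hd
  have h₃ : q₁ * q₂ ≤ u ^ 2 * v ^ 2 :=
    (mul_le_mul_of_nonneg_left h₂ hq₁).trans (mul_le_mul_of_nonneg_right h₁ (sq_nonneg v))
  have h₄ : q - q₁ - q₂ ≤ 2 * (u * v) := abs_le_of_sq_le_sq' (by nlinarith) (by positivity) |>.2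
  nlinarith

lemma minorForm_add_le {p : ℕ} {ω : Fin p × Fin p → ℂ} (h : IsMinorBound ω)
    {X Y : Matrix (Fin p) (Fin 2) ℂ} {u v : ℝ} (hu : 0 ≤ u) (hv : 0 ≤ v)
    (hX : minorForm ω X ≤ u ^ 2) (hY : minorForm ω Y ≤ v ^ 2) :
    minorForm ω (X + Y) ≤ (u + v) ^ 2 := by
  have hnn : ∀ M, 0 ≤ minorForm ω M := fun M => (sq_nonneg _).trans (minorForm_nonneg h M)
  refine le_add_sq_of_quadratic_nonneg hu hv hX hY (hnn X) fun t => ?_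
  rw [← minorForm_add_smul]
  exact hnn _

lemma lidskii {p : ℕ} {X Y Z : Matrix (Fin p) (Fin 2) ℂ} (h : X + Y + Z = 0) :
    singularValues Z 0 + singularValues Z 1 ≤
      singularValues X 0 + singularValues X 1 + singularValues Y 0 + singularValues Y 1 := by
  obtain ⟨ω, hω, hZ⟩ := exists_isMinorBound_eq Z
  obtain ⟨hX₁, hX₀, -⟩ := singularValues_spec X
  obtain ⟨hY₁, hY₀, -⟩ := singularValues_spec Y
  have hle := minorForm_add_le hω.neg (by linarith) (by linarith) (minorForm_le hω.neg X)
    (minorForm_le hω.neg Y)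
  rw [eq_neg_of_add_eq_zero_left h, minorForm_neg_right] at hle
  have : minorForm (-ω) Z = (singularValues Z 0 + singularValues Z 1) ^ 2 := by
    simp only [minorForm, Pi.neg_apply, neg_mul, Complex.neg_re, Finset.sum_neg_distrib, hZ,
      ← (singularValues_spec Z).2.2.1]
    ring
  rw [this] at hle
  linarith [le_of_sq_le_sq_of_nonneg hle (by linarith)]

lemma signed_lidskii {p : ℕ} {X Y Z : Matrix (Fin p) (Fin 2) ℂ} (h : X + Y + Z = 0) :
    singularValues Z 0 - singularValues Z 1 ≤
      singularValues X 0 + singularValues X 1 + singularValues Y 0 - singularValues Y 1 := by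
  obtain ⟨ω, hω, hY⟩ := exists_isMinorBound_eq Y
  obtain ⟨hX₁, hX₀, -⟩ := singularValues_spec X
  obtain ⟨hY₁, hY₀, hYs, -⟩ := singularValues_spec Y
  have hYle : minorForm ω Y ≤ (singularValues Y 0 - singularValues Y 1) ^ 2 := by
    simp only [minorForm, hY, ← hYs]
    linarith
  have hle := minorForm_add_le hω (by linarith) (by linarith) (minorForm_le hω X) hYle
  rw [eq_neg_of_add_eq_zero_left h, minorForm_neg_right] at hle
  linarith [le_of_sq_le_sq_of_nonneg ((minorForm_nonneg hω Z).trans hle) (by linarith)]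

lemma norm_sq_mulVec {p : ℕ} (M : Matrix (Fin p) (Fin 2) ℂ) (v : Fin 2 → ℂ) :
    ‖WithLp.toLp 2 (M *ᵥ v)‖ ^ 2 = colNormSq M 0 * Complex.normSq (v 0) +
      colNormSq M 1 * Complex.normSq (v 1) +
      2 * (colInner M * (starRingEnd ℂ (v 0) * v 1)).re := by
  have h : ∀ i, Complex.normSq (M i 0 * v 0 + M i 1 * v 1) =
      Complex.normSq (M i 0) * Complex.normSq (v 0) +
      Complex.normSq (M i 1) * Complex.normSq (v 1) +
      2 * (starRingEnd ℂ (M i 0) * M i 1 * (starRingEnd ℂ (v 0) * v 1)).re := by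
    intro i
    simp [Complex.normSq_apply]
    ring
  simp only [EuclideanSpace.norm_sq_eq, mulVec, dotProduct, Fin.sum_univ_two,
    ← Complex.normSq_eq_norm_sq, h, Finset.sum_add_distrib, colNormSq, colInner, Finset.sum_mul,
    Complex.re_sum, Finset.mul_sum]

lemma norm_sq_toLp (v : Fin 2 → ℂ) :
    ‖WithLp.toLp 2 v‖ ^ 2 = Complex.normSq (v 0) + Complex.normSq (v 1) := by
  simp [EuclideanSpace.norm_sq_eq, Complex.normSq_eq_norm_sq]

lemma two_mul_abs_re_le {P R : ℝ} {γ x y : ℂ} (hP : 0 ≤ P) (hR : 0 ≤ R)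
    (h : P * R = Complex.normSq γ) :
    2 * |(γ * (starRingEnd ℂ x * y)).re| ≤ P * Complex.normSq x + R * Complex.normSq y := by
  have h₁ : |(γ * (starRingEnd ℂ x * y)).re| ^ 2 ≤
      P * Complex.normSq x * (R * Complex.normSq y) := by
    rw [sq_abs]
    calc _ ≤ Complex.normSq (γ * (starRingEnd ℂ x * y)) := by
          rw [Complex.normSq_apply]
          nlinarith [sq_nonneg (γ * (starRingEnd ℂ x * y)).im]
      _ = _ := by rw [map_mul, map_mul, Complex.normSq_conj, ← h]; ring
  have hx := mul_nonneg hP (Complex.normSq_nonneg x)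
  have hy := mul_nonneg hR (Complex.normSq_nonneg y)
  refine le_of_sq_le_sq_of_nonneg ?_ (add_nonneg hx hy)
  nlinarith [sq_nonneg (P * Complex.normSq x - R * Complex.normSq y)]

lemma colNormSq_nonneg {p : ℕ} (M : Matrix (Fin p) (Fin 2) ℂ) (j : Fin 2) : 0 ≤ colNormSq M j :=
  Finset.sum_nonneg fun _ _ => Complex.normSq_nonneg _

lemma nonneg_of_add_nonneg_of_mul_nonneg {x y : ℝ} (h₁ : 0 ≤ x + y) (h₂ : 0 ≤ x * y) :
    0 ≤ x ∧ 0 ≤ y := by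
  constructor <;> by_contra! h <;> nlinarith

lemma norm_mulVec_le {p : ℕ} (M : Matrix (Fin p) (Fin 2) ℂ) (v : Fin 2 → ℂ) :
    ‖WithLp.toLp 2 (M *ᵥ v)‖ ≤ singularValues M 0 * ‖WithLp.toLp 2 v‖ := by
  obtain ⟨h₁, h₀, hs, hp⟩ := singularValues_spec M
  refine le_of_sq_le_sq_of_nonneg ?_ (mul_nonneg (h₁.trans h₀) (norm_nonneg _))
  rw [norm_sq_mulVec, mul_pow, norm_sq_toLp]
  have hprod : (singularValues M 0 ^ 2 - colNormSq M 0) * (singularValues M 0 ^ 2 - colNormSq M 1) =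
      Complex.normSq (colInner M) := by
    linear_combination singularValues M 0 ^ 2 * hs - hp
  obtain ⟨hP, hR⟩ := nonneg_of_add_nonneg_of_mul_nonneg
    (by nlinarith) (hprod ▸ Complex.normSq_nonneg _)
  have := two_mul_abs_re_le (x := v 0) (y := v 1) hP hR hprod
  linarith [le_abs_self (colInner M * (starRingEnd ℂ (v 0) * v 1)).re]

lemma le_norm_mulVec {p : ℕ} (M : Matrix (Fin p) (Fin 2) ℂ) (v : Fin 2 → ℂ) :
    singularValues M 1 * ‖WithLp.toLp 2 v‖ ≤ ‖WithLp.toLp 2 (M *ᵥ v)‖ := by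
  obtain ⟨h₁, h₀, hs, hp⟩ := singularValues_spec M
  refine le_of_sq_le_sq_of_nonneg ?_ (norm_nonneg _)
  rw [norm_sq_mulVec, mul_pow, norm_sq_toLp]
  have hprod : (colNormSq M 0 - singularValues M 1 ^ 2) * (colNormSq M 1 - singularValues M 1 ^ 2) =
      Complex.normSq (colInner M) := by
    linear_combination singularValues M 1 ^ 2 * hs - hp
  obtain ⟨hP, hR⟩ := nonneg_of_add_nonneg_of_mul_nonneg
    (by nlinarith) (hprod ▸ Complex.normSq_nonneg _)
  have := two_mul_abs_re_le (x := v 0) (y := v 1) hP hR hprod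
  linarith [neg_abs_le (colInner M * (starRingEnd ℂ (v 0) * v 1)).re]

lemma exists_norm_mulVec_eq {p : ℕ} (M : Matrix (Fin p) (Fin 2) ℂ) (j : Fin 2) :
    ∃ v : Fin 2 → ℂ, 0 < ‖WithLp.toLp 2 v‖ ∧
      ‖WithLp.toLp 2 (M *ᵥ v)‖ = singularValues M j * ‖WithLp.toLp 2 v‖ := by
  obtain ⟨h₁, h₀, hs, hp⟩ := singularValues_spec M
  have hj : 0 ≤ singularValues M j := Real.sqrt_nonneg _
  have hprod : (singularValues M j ^ 2 - colNormSq M 0) * (singularValues M j ^ 2 - colNormSq M 1) =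
      Complex.normSq (colInner M) := by
    fin_cases j
    · simp only [Fin.zero_eta]
      linear_combination singularValues M 0 ^ 2 * hs - hp
    · simp only [Fin.mk_one]
      linear_combination singularValues M 1 ^ 2 * hs - hp
  suffices ∃ v : Fin 2 → ℂ, v ≠ 0 ∧ ‖WithLp.toLp 2 (M *ᵥ v)‖ ^ 2 =
      singularValues M j ^ 2 * ‖WithLp.toLp 2 v‖ ^ 2 by
    obtain ⟨v, hv, h⟩ := this
    refine ⟨v, norm_pos_iff.2 (by simpa using hv), ?_⟩
    rw [← mul_pow] at h
    exact (sq_eq_sq₀ (norm_nonneg _) (mul_nonneg hj (norm_nonneg _))).1 h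
  set m := singularValues M j ^ 2 - colNormSq M 0 with hm
  by_cases hz : m = 0
  · have hγ : colInner M = 0 := by simpa [hz] using hprod.symm
    refine ⟨![1, 0], fun h => by simpa using congrFun h 0, ?_⟩
    rw [norm_sq_mulVec, norm_sq_toLp]
    simp only [hγ, cons_val_zero, cons_val_one, map_one, map_zero, mul_zero, Complex.zero_re]
    linarith
  · refine ⟨![colInner M, m], fun h => hz (by simpa using congrFun h 1), ?_⟩
    rw [norm_sq_mulVec, norm_sq_toLp]
    have : (colInner M * (starRingEnd ℂ (colInner M) * m)).re =
        Complex.normSq (colInner M) * m := by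
      rw [← mul_assoc, Complex.mul_conj, ← Complex.ofReal_mul, Complex.ofReal_re]
    simp only [cons_val_zero, cons_val_one, this, Complex.normSq_ofReal]
    rw [← hprod, show singularValues M j ^ 2 = m + colNormSq M 0 by rw [hm]; ring]
    ring

lemma norm_mulVec_le_add {p : ℕ} {X Y Z : Matrix (Fin p) (Fin 2) ℂ} (h : X + Y + Z = 0)
    (v : Fin 2 → ℂ) : ‖WithLp.toLp 2 (Z *ᵥ v)‖ ≤
      ‖WithLp.toLp 2 (X *ᵥ v)‖ + ‖WithLp.toLp 2 (Y *ᵥ v)‖ := by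
  rw [eq_neg_of_add_eq_zero_right h, neg_mulVec, add_mulVec, WithLp.toLp_neg, norm_neg,
    WithLp.toLp_add]
  exact norm_add_le _ _

lemma weyl_zero {p : ℕ} {X Y Z : Matrix (Fin p) (Fin 2) ℂ} (h : X + Y + Z = 0) :
    singularValues Z 0 ≤ singularValues X 0 + singularValues Y 0 := by
  obtain ⟨v, hv, hZ⟩ := exists_norm_mulVec_eq Z 0
  apply le_of_mul_le_mul_right _ hv
  linarith [norm_mulVec_le_add h v, norm_mulVec_le X v, norm_mulVec_le Y v]

lemma weyl_one {p : ℕ} {X Y Z : Matrix (Fin p) (Fin 2) ℂ} (h : X + Y + Z = 0) :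
    singularValues Z 1 ≤ singularValues X 0 + singularValues Y 1 := by
  obtain ⟨v, hv, hY⟩ := exists_norm_mulVec_eq Y 1
  apply le_of_mul_le_mul_right _ hv
  linarith [norm_mulVec_le_add h v, norm_mulVec_le X v, le_norm_mulVec Z v]

lemma singularValues_inequalities {p : ℕ} {X Y Z : Matrix (Fin p) (Fin 2) ℂ}
    (h : X + Y + Z = 0) {x y z : Fin 2 → ℝ} (hx : singularValues X = x) (hy : singularValues Y = y)
    (hz : singularValues Z = z) :
    x 0 + y 0 ≥ z 0 ∧ x 0 + y 1 ≥ z 1 ∧ x 0 + x 1 + y 0 + y 1 ≥ z 0 + z 1 ∧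
      x 0 + x 1 + y 0 - y 1 ≥ z 0 - z 1 := by
  subst hx hy hz
  exact ⟨weyl_zero h, weyl_one h, lidskii h, signed_lidskii h⟩

/-- For `p ≥ 2`, a triple `(a,b,c) ∈ (ℝ²_{++})³` belongs to `Singular(p,2)` if and only
if, for every permutation `(x,y,z)` of `(a,b,c)`, the Weyl inequalities
`x₁ + y₁ ≥ z₁`, `x₁ + y₂ ≥ z₂`, the Lidskii inequality
`x₁ + x₂ + y₁ + y₂ ≥ z₁ + z₂`, and the signed Lidskii inequality
`x₁ + x₂ + y₁ − y₂ ≥ z₁ − z₂` hold. -/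
theorem singular_p_two (p : ℕ) (hp : 2 ≤ p) (a b c : Fin 2 → ℝ)
    (ha : a 1 ≤ a 0 ∧ 0 ≤ a 1) (hb : b 1 ≤ b 0 ∧ 0 ≤ b 1) (hc : c 1 ≤ c 0 ∧ 0 ≤ c 1) :
    (a, b, c) ∈ SingularCone p 2 ↔
      ∀ (σ : Equiv.Perm (Fin 3)) (x y z : Fin 2 → ℝ),
        x = ![a, b, c] (σ 0) → y = ![a, b, c] (σ 1) → z = ![a, b, c] (σ 2) →
        x 0 + y 0 ≥ z 0 ∧
        x 0 + y 1 ≥ z 1 ∧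
        x 0 + x 1 + y 0 + y 1 ≥ z 0 + z 1 ∧
        x 0 + x 1 + y 0 - y 1 ≥ z 0 - z 1 := by
  constructor
  · rintro ⟨A, B, C, h, hA, hB, hC⟩ σ x y z hx hy hz
    have hsv : ∀ i, singularValues (![A, B, C] i) = ![a, b, c] i := by
      intro i
      fin_cases i
      · exact hA
      · exact hB
      · exact hC
    refine singularValues_inequalities (X := ![A, B, C] (σ 0)) (Y := ![A, B, C] (σ 1))
      (Z := ![A, B, C] (σ 2)) ?_ ((hsv _).trans hx.symm) ((hsv _).trans hy.symm)
      ((hsv _).trans hz.symm)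
    rw [← Fin.sum_univ_three (fun i => ![A, B, C] (σ i)), Equiv.sum_comp σ ![A, B, C],
      Fin.sum_univ_three]
    exact h
  · intro h
    have key : ∀ i j k : Fin 3, i ≠ j → i ≠ k → j ≠ k → ∃ σ : Equiv.Perm (Fin 3),
        σ 0 = i ∧ σ 1 = j ∧ σ 2 = k := by decide
    have h' : ∀ i j k : Fin 3, i ≠ j → i ≠ k → j ≠ k →
        ![a, b, c] i 0 + ![a, b, c] j 0 ≥ ![a, b, c] k 0 ∧
        ![a, b, c] i 0 + ![a, b, c] j 1 ≥ ![a, b, c] k 1 ∧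
        ![a, b, c] i 0 + ![a, b, c] i 1 + ![a, b, c] j 0 + ![a, b, c] j 1 ≥
          ![a, b, c] k 0 + ![a, b, c] k 1 ∧
        ![a, b, c] i 0 + ![a, b, c] i 1 + ![a, b, c] j 0 - ![a, b, c] j 1 ≥
          ![a, b, c] k 0 - ![a, b, c] k 1 := by
      intro i j k hij hik hjk
      obtain ⟨σ, rfl, rfl, rfl⟩ := key i j k hij hik hjk
      exact h σ _ _ _ rfl rfl rfl
    obtain ⟨w₁, v₁, l₁, s₁⟩ := h' 0 1 2 (by decide) (by decide) (by decide)
    obtain ⟨w₂, v₂, l₂, s₂⟩ := h' 1 0 2 (by decide) (by decide) (by decide)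
    obtain ⟨w₃, v₃, l₃, s₃⟩ := h' 0 2 1 (by decide) (by decide) (by decide)
    obtain ⟨w₄, v₄, l₄, s₄⟩ := h' 2 0 1 (by decide) (by decide) (by decide)
    obtain ⟨w₅, v₅, l₅, s₅⟩ := h' 1 2 0 (by decide) (by decide) (by decide)
    obtain ⟨w₆, v₆, l₆, s₆⟩ := h' 2 1 0 (by decide) (by decide) (by decide)
    simp only [cons_val] at *
    apply mem_singularCone_of_realizable hp ha hb hc
    apply realizable_of_inequalities ha.1 ha.2 hb.1 hb.2 hc.1 hc.2 <;> linarith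
end

section
/- For every p ≥ 3, Singular(p,3) = Singular(3,3); in particular the union Singular(∞,3) = ⋃_{p ≥ 3} Singular(p,3) equals Singular(3,3). -/
open Matrix

theorem eigsDesc_congr {n : ℕ} {M N : Matrix (Fin n) (Fin n) ℂ} (hM : M.IsHermitian)
    (hN : N.IsHermitian) (h : M = N) : eigsDesc hM = eigsDesc hN := by
  subst h
  rfl

/-- The singular values depend only on the Gram matrix. -/
theorem singularValues_congr {p p' q : ℕ} {A : Matrix (Fin p) (Fin q) ℂ}
    {B : Matrix (Fin p') (Fin q) ℂ} (h : Aᴴ * A = Bᴴ * B) :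
    singularValues A = singularValues B := by
  funext i
  unfold singularValues
  rw [eigsDesc_congr _ (isHermitian_conjTranspose_mul_self B) h]

/-- For `q ≤ p`, the columns of a `p × q` matrix lie in the range of some isometry
`ℂ^q → ℂ^p`. -/
theorem exists_isometry_range {p q : ℕ} (hpq : q ≤ p) (W : Matrix (Fin p) (Fin q) ℂ) :
    ∃ J : Matrix (Fin p) (Fin q) ℂ, Jᴴ * J = 1 ∧ J * (Jᴴ * W) = W := by
  let f : Fin p → EuclideanSpace ℂ (Fin p) := fun j =>
    if h : (j : ℕ) < q then WithLp.toLp 2 fun i => W i ⟨j, h⟩ else 0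
  let b : OrthonormalBasis (Fin p) ℂ (EuclideanSpace ℂ (Fin p)) :=
    InnerProductSpace.gramSchmidtOrthonormalBasis (by simp) f
  have hf (j : Fin q) : f (Fin.castLE hpq j) = WithLp.toLp 2 fun i => W i j := by simp [f]
  let J : Matrix (Fin p) (Fin q) ℂ := Matrix.of fun i k => b (Fin.castLE hpq k) i
  have hJW (k j : Fin q) :
      (Jᴴ * W) k j = inner ℂ (b (Fin.castLE hpq k)) (f (Fin.castLE hpq j)) := by
    rw [hf]
    simp [J, Matrix.mul_apply, PiLp.inner_apply, mul_comm]
  refine ⟨J, ?_, ?_⟩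
  · ext k l
    have h := orthonormal_iff_ite.1 b.orthonormal (Fin.castLE hpq k) (Fin.castLE hpq l)
    simp only [(Fin.castLE_injective hpq).eq_iff] at h
    rw [Matrix.one_apply, ← h]
    simp [J, Matrix.mul_apply, PiLp.inner_apply, mul_comm]
  · ext i j
    have h := congrArg (fun x : EuclideanSpace ℂ (Fin p) => x i)
      (b.sum_repr' (f (Fin.castLE hpq j)))
    have hW : (f (Fin.castLE hpq j)) i = W i j := by rw [hf]
    simp only [hW] at h
    rw [← h, Matrix.mul_apply]
    simp only [hJW, WithLp.ofLp_sum, WithLp.ofLp_smul, Finset.sum_apply, Pi.smul_apply,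
      smul_eq_mul]
    rw [← Finset.sum_subset (Finset.subset_univ (Finset.univ.map (Fin.castLEEmb hpq)))]
    · simp [J, mul_comm]
    · intro m _ hm
      have hlt : Fin.castLE hpq j < m := by
        by_contra hcon
        refine hm ?_
        have hmj : (m : ℕ) ≤ j := by simpa [Fin.le_def] using hcon
        exact Finset.mem_map.2 ⟨⟨m, by omega⟩, Finset.mem_univ _, by ext; simp⟩
      rw [InnerProductSpace.gramSchmidtOrthonormalBasis_inv_triangular _ _ hlt, zero_mul]

theorem re_trace_gram {p q : ℕ} (V : Matrix (Fin p) (Fin q) ℂ) :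
    (Vᴴ * V).trace.re = ∑ j, ∑ i, ‖V i j‖ ^ 2 := by
  simp only [Matrix.trace, Matrix.diag, Matrix.mul_apply, conjTranspose_apply, Complex.re_sum]
  refine Finset.sum_congr rfl fun j _ => Finset.sum_congr rfl fun i _ => ?_
  rw [← Complex.normSq_eq_norm_sq, Complex.normSq_apply]
  simp

theorem norm_sq_le_re_trace_gram {p q : ℕ} (V : Matrix (Fin p) (Fin q) ℂ) (i : Fin p)
    (j : Fin q) : ‖V i j‖ ^ 2 ≤ (Vᴴ * V).trace.re := by
  rw [re_trace_gram]
  exact (Finset.single_le_sum (f := fun i => ‖V i j‖ ^ 2) (fun _ _ => by positivity)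
    (Finset.mem_univ i)).trans
    (Finset.single_le_sum (f := fun j => ∑ i, ‖V i j‖ ^ 2) (fun _ _ => by positivity)
    (Finset.mem_univ j))

theorem isCompact_setOf_gram_eq {p q : ℕ} (R S : Matrix (Fin q) (Fin q) ℂ) :
    IsCompact {x : Matrix (Fin p) (Fin q) ℂ × Matrix (Fin p) (Fin q) ℂ |
      x.1ᴴ * x.1 + x.2ᴴ * x.2 = R ∧ x.1ᴴ * x.2 = S} := by
  let r := Real.sqrt R.trace.re
  let K : Set (Matrix (Fin p) (Fin q) ℂ) :=
    Set.pi Set.univ fun _ => Set.pi Set.univ fun _ => Metric.closedBall (0 : ℂ) r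
  have hK : IsCompact K :=
    isCompact_univ_pi fun _ => isCompact_univ_pi fun _ => isCompact_closedBall _ _
  refine (hK.prod hK).of_isClosed_subset ?_ ?_
  · exact (isClosed_eq (by fun_prop) continuous_const).inter
      (isClosed_eq (by fun_prop) continuous_const)
  · rintro ⟨V, W⟩ ⟨h, -⟩
    have htr : (Vᴴ * V).trace.re + (Wᴴ * W).trace.re = R.trace.re := by
      rw [← h, Matrix.trace_add, Complex.add_re]
    have h0 (M : Matrix (Fin p) (Fin q) ℂ) : 0 ≤ (Mᴴ * M).trace.re := by
      rw [re_trace_gram]; positivity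
    refine ⟨fun i _ j _ => ?_, fun i _ j _ => ?_⟩ <;> rw [mem_closedBall_zero_iff]
    · exact Real.le_sqrt_of_sq_le (by linarith [norm_sq_le_re_trace_gram V i j, h0 W])
    · exact Real.le_sqrt_of_sq_le (by linarith [norm_sq_le_re_trace_gram W i j, h0 V])

/-- Matrix Fejér–Riesz factorization for a linear pencil: the pencil `V + ζ W` on the unit circle
may be replaced by a square one with the same Gram matrices. -/
theorem exists_square_pencil {p q : ℕ} (hpq : q ≤ p) (V W : Matrix (Fin p) (Fin q) ℂ) :
    ∃ V' W' : Matrix (Fin q) (Fin q) ℂ,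
      V'ᴴ * V' + W'ᴴ * W' = Vᴴ * V + Wᴴ * W ∧ V'ᴴ * W' = Vᴴ * W := by
  obtain ⟨⟨V₀, W₀⟩, ⟨hsum, hmul⟩, hmin⟩ :=
    (isCompact_setOf_gram_eq (p := p) (Vᴴ * V + Wᴴ * W) (Vᴴ * W)).exists_isMinOn
      ⟨(V, W), rfl, rfl⟩
      (f := fun x => (x.1ᴴ * x.1).trace.re) (by fun_prop)
  obtain ⟨J, hJ, hJW⟩ := exists_isometry_range hpq W₀
  simp only at hsum hmul
  have hWJ : W₀ᴴ * J * Jᴴ = W₀ᴴ := by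
    have := congrArg conjTranspose hJW
    simpa [conjTranspose_mul, Matrix.mul_assoc] using this
  -- Moving the part of `V₀` orthogonal to the range of `J` to `W₀` lowers the trace.
  obtain ⟨D, hD⟩ : ∃ D, D = V₀ - J * (Jᴴ * V₀) := ⟨_, rfl⟩
  have hV : V₀ = J * (Jᴴ * V₀) + D := by rw [hD]; abel
  have hJD : Jᴴ * D = 0 := by
    rw [hD, Matrix.mul_sub, ← Matrix.mul_assoc Jᴴ J, hJ, Matrix.one_mul, sub_self]
  have hDJ : Dᴴ * J = 0 := by simpa using congrArg conjTranspose hJD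
  have hWD : W₀ᴴ * D = 0 := by rw [← hWJ, Matrix.mul_assoc, hJD, Matrix.mul_zero]
  have hDW : Dᴴ * W₀ = 0 := by simpa using congrArg conjTranspose hWD
  obtain ⟨X, hX⟩ : ∃ X, X = Jᴴ * V₀ := ⟨_, rfl⟩
  rw [← hX] at hV
  have hgram : V₀ᴴ * V₀ = (J * X)ᴴ * (J * X) + Dᴴ * D := by
    rw [hV, conjTranspose_add, conjTranspose_mul, Matrix.add_mul, Matrix.mul_add, Matrix.mul_add,
      Matrix.mul_assoc Xᴴ Jᴴ D, hJD, ← Matrix.mul_assoc Dᴴ J X, hDJ]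
    simp
  have hle := hmin (show (J * X, W₀ + D) ∈ _ from ⟨by
      rw [← hsum, hgram]
      simp only [conjTranspose_add, Matrix.add_mul, Matrix.mul_add, hWD, hDW]
      abel, by
      rw [← hmul, hV]
      simp only [conjTranspose_add, conjTranspose_mul, Matrix.add_mul, Matrix.mul_add, hDW,
        Matrix.mul_assoc, hJD, Matrix.mul_zero]⟩)
  have hD0 : D = 0 := by
    simp only [hgram, Matrix.trace_add, Complex.add_re] at hle
    ext i j
    have h1 := norm_sq_le_re_trace_gram D i j
    have h2 : ‖D i j‖ ^ 2 ≤ 0 := by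
      simp only [Set.mem_ofPred_eq] at hle
      linarith
    simpa using pow_eq_zero_iff two_ne_zero |>.1 (le_antisymm h2 (by positivity))
  rw [hD0, add_zero] at hV
  refine ⟨X, Jᴴ * W₀, ?_, ?_⟩
  · rw [← hsum, hV, conjTranspose_mul, conjTranspose_mul, conjTranspose_conjTranspose,
      Matrix.mul_assoc, hJW, Matrix.mul_assoc Xᴴ, ← Matrix.mul_assoc Jᴴ J, hJ, Matrix.one_mul]
  · rw [← hmul, hV, conjTranspose_mul, Matrix.mul_assoc]

/-- The Gram matrix of `α V + β W` with `|α| = |β|` depends only on `Vᴴ V + Wᴴ W` and `Vᴴ W`. -/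
theorem gram_smul_add_smul_congr {p p' q : ℕ} {α β : ℂ} (hαβ : star α * α = star β * β)
    {V W : Matrix (Fin p) (Fin q) ℂ} {V' W' : Matrix (Fin p') (Fin q) ℂ}
    (hsum : Vᴴ * V + Wᴴ * W = V'ᴴ * V' + W'ᴴ * W') (hmul : Vᴴ * W = V'ᴴ * W') :
    (α • V + β • W)ᴴ * (α • V + β • W) = (α • V' + β • W')ᴴ * (α • V' + β • W') := by
  have expand {n : ℕ} (X Y : Matrix (Fin n) (Fin q) ℂ) :
      (α • X + β • Y)ᴴ * (α • X + β • Y) = (star α * α) • (Xᴴ * X + Yᴴ * Y) +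
        (star α * β) • (Xᴴ * Y) + (star β * α) • (Xᴴ * Y)ᴴ := by
    simp only [conjTranspose_add, conjTranspose_smul, conjTranspose_mul,
      conjTranspose_conjTranspose, Matrix.add_mul, Matrix.mul_add, Matrix.smul_mul,
      Matrix.mul_smul, smul_smul, smul_add, mul_comm α, mul_comm β]
    rw [← hαβ]
    abel
  rw [expand, expand, hsum, hmul]

/-- The union over `p` of the singular cones stabilizes at `p = q`. -/
theorem singularCone_eq_square {p q : ℕ} (hpq : q ≤ p) :
    SingularCone p q = SingularCone q q := by
  refine Set.Subset.antisymm ?_ ?_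
  · rintro ⟨a, b, c⟩ ⟨A, B, C, hABC, rfl, rfl, rfl⟩
    obtain ⟨V, W, hsum, hmul⟩ := exists_square_pencil hpq
      ((1 / 2 : ℂ) • A + (Complex.I / 2) • B) ((1 / 2 : ℂ) • A - (Complex.I / 2) • B)
    have hI : Complex.I ^ 2 = -1 := Complex.I_sq
    have hC : C = -(A + B) := (neg_eq_of_add_eq_zero_right hABC).symm
    have key {α β : ℂ} (h : star α * α = star β * β) {D : Matrix (Fin p) (Fin q) ℂ}
        (hD : D = α • ((1 / 2 : ℂ) • A + (Complex.I / 2) • B) +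
          β • ((1 / 2 : ℂ) • A - (Complex.I / 2) • B)) :
        singularValues (α • V + β • W) = singularValues D := by
      rw [hD]
      exact singularValues_congr (gram_smul_add_smul_congr h hsum hmul)
    refine ⟨(1 : ℂ) • V + (1 : ℂ) • W, (-Complex.I) • V + Complex.I • W,
      (-1 + Complex.I) • V + (-1 - Complex.I) • W, ?_, key (by simp) ?_, key (by simp) ?_,
      key ?_ ?_⟩
    · module
    · module
    · ext i j
      simp only [Matrix.add_apply, Matrix.sub_apply, Matrix.smul_apply, smul_eq_mul]
      linear_combination B i j * hI
    · simp only [star_add, star_sub, star_neg, star_one, Complex.star_def, Complex.conj_I]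
      ring
    · rw [hC]
      ext i j
      simp only [Matrix.add_apply, Matrix.sub_apply, Matrix.neg_apply, Matrix.smul_apply,
        smul_eq_mul]
      linear_combination -B i j * hI
  · rintro ⟨a, b, c⟩ ⟨A, B, C, hABC, rfl, rfl, rfl⟩
    obtain ⟨J, hJ, -⟩ := exists_isometry_range hpq (0 : Matrix (Fin p) (Fin q) ℂ)
    have h (M : Matrix (Fin q) (Fin q) ℂ) : singularValues (J * M) = singularValues M := by
      refine singularValues_congr ?_
      rw [conjTranspose_mul, Matrix.mul_assoc, ← Matrix.mul_assoc Jᴴ, hJ, Matrix.one_mul]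
    exact ⟨J * A, J * B, J * C, by rw [← Matrix.mul_add, ← Matrix.mul_add, hABC, Matrix.mul_zero],
      h A, h B, h C⟩

/-- For every `p ≥ 3`, `Singular(p,3) = Singular(3,3)`; in particular
`Singular(∞,3) = ⋃_{p ≥ 3} Singular(p,3)` equals `Singular(3,3)`. -/
theorem singular_infty_three :
    (∀ p, 3 ≤ p → SingularCone p 3 = SingularCone 3 3) ∧
      (⋃ p, ⋃ (_ : 3 ≤ p), SingularCone p 3) = SingularCone 3 3 := by
  refine ⟨fun p hp => singularCone_eq_square hp, Set.Subset.antisymm ?_ ?_⟩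
  · exact Set.iUnion₂_subset fun p hp => (singularCone_eq_square hp).subset
  · exact Set.subset_iUnion₂_of_subset 3 le_rfl subset_rfl
end

section
/- Let p ≥ q ≥ 1 and let I_•, J_•, K_• be polarized subsets of [q], each of cardinal r ∈ [q]. If (λ(I^p_•), λ(J^p_•), λ(K^p_•) − (p+q−r)·1^r) ∈ Horn(r) and (λ(Ĩ^p_•), λ(J̃^p_•), λ(K̃^p_•) − (p+q−2r)·1^r) ∈ Horn(r), then the following two identities hold: (C2) |I_+| + |J_+| + |K_+| − (|I_−| + |J_−| + |K_−|) + r(r+1)/2 = (p+q+1)(♯I_+ + ♯J_+ + ♯K_+ − r), and (C3) (♯I_+)² + (♯J_+)² + (♯K_+)² + 2(δ_{I_•} + δ_{J_•} + δ_{K_•}) = r². -/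
open Matrix

/-- `Horn n` is the set of triples `(s(A), s(B), s(C))` of decreasing eigenvalue vectors of
Hermitian `n × n` matrices `A`, `B`, `C` with `A + B + C = 0`. -/
def Horn (n : ℕ) : Set ((Fin n → ℝ) × (Fin n → ℝ) × (Fin n → ℝ)) :=
  {t | ∃ (A B C : Matrix (Fin n) (Fin n) ℂ) (hA : A.IsHermitian) (hB : B.IsHermitian)
      (hC : C.IsHermitian), A + B + C = 0 ∧
      eigsDesc hA = t.1 ∧ eigsDesc hB = t.2.1 ∧ eigsDesc hC = t.2.2}

/-- `X^p_•` : given a polarized subset `X_• = (X_+, X_−)` of `[q]`, the subset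
`X_+ ∪ {p+q+1−x : x ∈ X_−}` of `[p+q]`. -/
def polToSet (p q : ℕ) (Xplus Xminus : Finset ℕ) : Finset ℕ :=
  Xplus ∪ Xminus.image (fun a => p + q + 1 - a)

/-- `λ(X)` for a subset `X = {x_1 < … < x_r}` of `[m]` : the vector with entries
`λ_a = m − r + a − x_a`, viewed in `ℝ^r`. -/
noncomputable def lambdaOf (m r : ℕ) (S : Finset ℕ) : Fin r → ℝ :=
  fun a => (m : ℝ) - r + (a.val + 1) - ((S.sort (· ≤ ·)).getD a.val 0 : ℝ)

/-- `(X^p_•)'` : writing the complement of `S = X^p_•` in `[p+q]` as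
`{u_1 < … < u_{p+q−r}}` and `S^o = {p+q+1−x : x ∈ S}`, this is
`{i ∈ [p+q−r] : u_i ∈ S^o}`. -/
def primeSet (p q r : ℕ) (S : Finset ℕ) : Finset ℕ :=
  (Finset.Icc 1 (p + q - r)).filter
    (fun i => ((Finset.Icc 1 (p + q) \ S).sort (· ≤ ·)).getD (i - 1) 0
      ∈ S.image (fun a => p + q + 1 - a))

/-- `X̃^p_• = {k ∈ [p+q−r] : p+q−r+1−k ∈ (X^p_•)'}`. -/
def tildeSet (p q r : ℕ) (S : Finset ℕ) : Finset ℕ :=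
  (Finset.Icc 1 (p + q - r)).filter (fun k => p + q - r + 1 - k ∈ primeSet p q r S)

/-- `1^r_α ∈ ℝ^r` : the vector with `α` ones followed by `r − α` zeros. -/
def oneVec (r α : ℕ) : Fin r → ℝ := fun i => if i.val < α then 1 else 0

/-- `δ_{X_•}` : the number of pairs `(a,b) ∈ X_+ × X_−` with `a < b`. -/
def deltaPol (Xplus Xminus : Finset ℕ) : ℕ :=
  ((Xplus ×ˢ Xminus).filter (fun ab => ab.1 < ab.2)).card

/-- The `i`-th coordinate (1-based) of a vector `x ∈ ℝ^q`, junk value `0` out of range. -/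
noncomputable def valAt {q : ℕ} (x : Fin q → ℝ) (i : ℕ) : ℝ :=
  if h : i - 1 < q then x ⟨i - 1, h⟩ else 0

/-- `x ∈ ℝ^q_{++}` : the coordinates of `x` are weakly decreasing and nonnegative. -/
def DecrNonneg {q : ℕ} (x : Fin q → ℝ) : Prop :=
  (∀ i j : Fin q, i ≤ j → x j ≤ x i) ∧ ∀ i, 0 ≤ x i

theorem sum_eigsDesc {n : ℕ} {A : Matrix (Fin n) (Fin n) ℂ} (hA : A.IsHermitian) :
    ((∑ i, eigsDesc hA i : ℝ) : ℂ) = A.trace := by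
  have h : ∑ i, eigsDesc hA i = ∑ i, hA.eigenvalues i :=
    Equiv.sum_comp (Fin.revPerm.trans (Tuple.sort hA.eigenvalues)) hA.eigenvalues
  rw [h, hA.trace_eq_sum_eigenvalues]
  simp

theorem sum_eq_zero_of_mem_Horn {n : ℕ} {x y z : Fin n → ℝ} (h : (x, y, z) ∈ Horn n) :
    ∑ i, x i + ∑ i, y i + ∑ i, z i = 0 := by
  obtain ⟨A, B, C, hA, hB, hC, hABC, rfl, rfl, rfl⟩ := h
  have ht := congrArg Matrix.trace hABC
  rw [Matrix.trace_add, Matrix.trace_add, Matrix.trace_zero, ← sum_eigsDesc hA,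
    ← sum_eigsDesc hB, ← sum_eigsDesc hC] at ht
  exact_mod_cast ht

theorem sort_getD_eq_orderEmbOfFin {S : Finset ℕ} {r : ℕ} (h : S.card = r) (i : Fin r) :
    (S.sort (· ≤ ·)).getD i 0 = S.orderEmbOfFin h i := by
  rw [Finset.orderEmbOfFin_apply]
  exact List.getD_eq_getElem _ _ _

theorem sum_lambdaOf (m : ℕ) {r : ℕ} {S : Finset ℕ} (h : S.card = r) :
    ∑ a, lambdaOf m r S a
      = r * ((m : ℝ) - r) + r * ((r : ℝ) + 1) / 2 - ((∑ x ∈ S, x : ℕ) : ℝ) := by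
  have hS : ∑ a : Fin r, (S.sort (· ≤ ·)).getD a 0 = ∑ x ∈ S, x := by
    conv_rhs => rw [← S.map_orderEmbOfFin_univ h, Finset.sum_map]
    exact Finset.sum_congr rfl fun i _ => sort_getD_eq_orderEmbOfFin h i
  have hg : ∀ n : ℕ, ∑ a : Fin n, ((a.val : ℝ) + 1) = n * ((n : ℝ) + 1) / 2 := by
    intro n
    induction n with
    | zero => simp
    | succ k ih =>
      rw [Fin.sum_univ_castSucc]
      simp only [Fin.val_castSucc, Fin.val_last, ih]
      push_cast
      ring
  simp only [lambdaOf, Finset.sum_sub_distrib, Finset.sum_add_distrib (f := fun _ => (m : ℝ) - r),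
    hg, ← hS]
  simp
  ring

/-- The position of `y` in the increasing enumeration of `T`, counted from `1` when `y ∈ T`. -/
def rankIn (T : Finset ℕ) (y : ℕ) : ℕ := (T.filter (· ≤ y)).card

theorem rankIn_orderEmbOfFin {T : Finset ℕ} {n : ℕ} (h : T.card = n) (i : Fin n) :
    rankIn T (T.orderEmbOfFin h i) = i + 1 := by
  have : T.filter (· ≤ T.orderEmbOfFin h i)
      = (Finset.Iic i).map (T.orderEmbOfFin h).toEmbedding := by
    conv_lhs => enter [2]; rw [← T.map_orderEmbOfFin_univ h]
    ext y
    simp only [Finset.mem_filter, Finset.mem_map, Finset.mem_univ, Finset.mem_Iic, true_and]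
    constructor
    · rintro ⟨⟨j, rfl⟩, hj⟩
      exact ⟨j, by simpa using hj, rfl⟩
    · rintro ⟨j, hj, rfl⟩
      exact ⟨⟨j, rfl⟩, by simpa using hj⟩
  rw [rankIn, this, Finset.card_map, Fin.card_Iic]

theorem rankIn_injOn (T : Finset ℕ) : Set.InjOn (rankIn T) T := by
  intro x hx y hy hxy
  rw [← T.range_orderEmbOfFin rfl] at hx hy
  obtain ⟨i, rfl⟩ := hx
  obtain ⟨j, rfl⟩ := hy
  rw [rankIn_orderEmbOfFin, rankIn_orderEmbOfFin] at hxy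
  rw [Fin.ext (Nat.succ_injective hxy)]

theorem filter_sort_getD_mem {T U : Finset ℕ} (hU : U ⊆ T) :
    (Finset.Icc 1 T.card).filter (fun i => (T.sort (· ≤ ·)).getD (i - 1) 0 ∈ U)
      = U.image (rankIn T) := by
  ext k
  simp only [Finset.mem_filter, Finset.mem_Icc, Finset.mem_image]
  constructor
  · rintro ⟨⟨h1, h2⟩, hk⟩
    have e := sort_getD_eq_orderEmbOfFin rfl (⟨k - 1, by omega⟩ : Fin T.card)
    refine ⟨_, hk, ?_⟩
    rw [e, rankIn_orderEmbOfFin]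
    simp only
    omega
  · rintro ⟨y, hy, rfl⟩
    have hyT := Finset.mem_coe.2 (hU hy)
    rw [← T.range_orderEmbOfFin rfl] at hyT
    obtain ⟨i, rfl⟩ := hyT
    rw [rankIn_orderEmbOfFin]
    refine ⟨⟨by omega, i.2⟩, ?_⟩
    rw [Nat.add_sub_cancel, sort_getD_eq_orderEmbOfFin rfl]
    exact hy

theorem rankIn_sdiff_add {N : ℕ} {S : Finset ℕ} (hS : S ⊆ Finset.Icc 1 N) {y : ℕ}
    (hy : y ≤ N) :
    rankIn (Finset.Icc 1 N \ S) y + rankIn S y = y := by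
  rw [rankIn, rankIn, ← Finset.card_union_of_disjoint, ← Finset.filter_union,
    Finset.sdiff_union_of_subset hS]
  · have : (Finset.Icc 1 N).filter (· ≤ y) = Finset.Icc 1 y := by
      ext k
      simp only [Finset.mem_filter, Finset.mem_Icc]
      omega
    simp [this]
  · exact Finset.disjoint_filter_filter Finset.sdiff_disjoint

theorem reflect_injOn {N : ℕ} {X : Finset ℕ} (hX : X ⊆ Finset.Icc 1 N) :
    Set.InjOn (fun a => N + 1 - a) (X : Set ℕ) := by
  intro x hx y hy hxy
  have hx' := Finset.mem_Icc.1 (hX hx)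
  have hy' := Finset.mem_Icc.1 (hX hy)
  simp only at hxy
  omega

theorem sum_reflect_add {N : ℕ} {X : Finset ℕ} (hX : X ⊆ Finset.Icc 1 N) :
    ∑ a ∈ X, (N + 1 - a) + ∑ a ∈ X, a = X.card * (N + 1) := by
  rw [← Finset.sum_add_distrib, ← smul_eq_mul, ← Finset.sum_const]
  refine Finset.sum_congr rfl fun a ha => ?_
  have := Finset.mem_Icc.1 (hX ha)
  omega

theorem sum_image_reflect_add {N : ℕ} {X : Finset ℕ} (hX : X ⊆ Finset.Icc 1 N) :
    ∑ y ∈ X.image (fun a => N + 1 - a), y + ∑ a ∈ X, a = X.card * (N + 1) := by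
  rw [Finset.sum_image (reflect_injOn hX), sum_reflect_add hX]

section Polarized

variable {p q : ℕ} {P M : Finset ℕ}

theorem polToSet_subset (hP : P ⊆ Finset.Icc 1 q) (hM : M ⊆ Finset.Icc 1 q) :
    polToSet p q P M ⊆ Finset.Icc 1 (p + q) := by
  intro x hx
  simp only [polToSet, Finset.mem_union, Finset.mem_image] at hx
  rw [Finset.mem_Icc]
  rcases hx with hx | ⟨a, ha, rfl⟩
  · have := Finset.mem_Icc.1 (hP hx)
    omega
  · have := Finset.mem_Icc.1 (hM ha)
    omega

theorem disjoint_image_reflect (hpq : q ≤ p) (hP : P ⊆ Finset.Icc 1 q)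
    (hM : M ⊆ Finset.Icc 1 q) : Disjoint P (M.image fun a => p + q + 1 - a) := by
  rw [Finset.disjoint_right]
  intro x hx hxP
  obtain ⟨a, ha, rfl⟩ := Finset.mem_image.1 hx
  have h1 := Finset.mem_Icc.1 (hM ha)
  have h2 := Finset.mem_Icc.1 (hP hxP)
  omega

theorem subset_Icc_add (hP : P ⊆ Finset.Icc 1 q) : P ⊆ Finset.Icc 1 (p + q) :=
  hP.trans (Finset.Icc_subset_Icc_right (Nat.le_add_left q p))

theorem card_polToSet (hpq : q ≤ p) (hP : P ⊆ Finset.Icc 1 q) (hM : M ⊆ Finset.Icc 1 q) :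
    (polToSet p q P M).card = P.card + M.card := by
  rw [polToSet, Finset.card_union_of_disjoint (disjoint_image_reflect hpq hP hM),
    Finset.card_image_of_injOn (reflect_injOn (subset_Icc_add hM))]

theorem sum_polToSet_add (hpq : q ≤ p) (hP : P ⊆ Finset.Icc 1 q) (hM : M ⊆ Finset.Icc 1 q) :
    ∑ x ∈ polToSet p q P M, x + ∑ x ∈ M, x = ∑ x ∈ P, x + M.card * (p + q + 1) := by
  rw [polToSet, Finset.sum_union (disjoint_image_reflect hpq hP hM), add_assoc,
    sum_image_reflect_add (subset_Icc_add hM)]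

theorem image_reflect_polToSet (hM : M ⊆ Finset.Icc 1 q) :
    (polToSet p q P M).image (fun a => p + q + 1 - a) = polToSet p q M P := by
  rw [polToSet, Finset.image_union, Finset.image_image, Finset.union_comm, polToSet]
  congr 1
  conv_rhs => rw [← Finset.image_id (s := M)]
  refine Finset.image_congr fun a ha => ?_
  have := Finset.mem_Icc.1 (hM ha)
  simp only [Function.comp, id]
  omega

theorem disjoint_polToSet_swap (hpq : q ≤ p) (hP : P ⊆ Finset.Icc 1 q)
    (hM : M ⊆ Finset.Icc 1 q) (hPM : Disjoint P M) :
    Disjoint (polToSet p q M P) (polToSet p q P M) := by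
  rw [polToSet, polToSet, Finset.disjoint_union_left, Finset.disjoint_union_right,
    Finset.disjoint_union_right]
  refine ⟨⟨hPM.symm, disjoint_image_reflect hpq hM hM⟩,
    (disjoint_image_reflect hpq hP hP).symm, ?_⟩
  rw [Finset.disjoint_left]
  intro x hx hx'
  obtain ⟨a, ha, rfl⟩ := Finset.mem_image.1 hx
  obtain ⟨b, hb, hab⟩ := Finset.mem_image.1 hx'
  have h1 := Finset.mem_Icc.1 (hP ha)
  have h2 := Finset.mem_Icc.1 (hM hb)
  obtain rfl : a = b := by omega
  exact Finset.disjoint_left.1 hPM ha hb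

theorem rankIn_polToSet (hpq : q ≤ p) (hP : P ⊆ Finset.Icc 1 q) (hM : M ⊆ Finset.Icc 1 q)
    (y : ℕ) : rankIn (polToSet p q P M) y
      = rankIn P y + (M.filter fun a => p + q + 1 - a ≤ y).card := by
  rw [rankIn, polToSet, Finset.filter_union, Finset.card_union_of_disjoint
    (Finset.disjoint_filter_filter (disjoint_image_reflect hpq hP hM)), Finset.filter_image,
    Finset.card_image_of_injOn, rankIn]
  exact (reflect_injOn (subset_Icc_add hM)).mono (Finset.filter_subset _ _)

theorem deltaPol_eq_sum_left (P M : Finset ℕ) :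
    deltaPol P M = ∑ a ∈ P, (M.filter fun b => a < b).card := by
  rw [deltaPol, Finset.card_filter, Finset.sum_product]
  simp only [Finset.card_filter]

theorem deltaPol_eq_sum_right (P M : Finset ℕ) :
    deltaPol P M = ∑ b ∈ M, (P.filter fun a => a < b).card := by
  rw [deltaPol, Finset.card_filter, Finset.sum_product_right]
  simp only [Finset.card_filter]

theorem sum_rankIn_polToSet (hpq : q ≤ p) (hP : P ⊆ Finset.Icc 1 q) (hM : M ⊆ Finset.Icc 1 q)
    (hPM : Disjoint P M) :
    ∑ y ∈ polToSet p q M P, rankIn (polToSet p q P M) y = 2 * deltaPol P M + P.card ^ 2 := by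
  rw [show polToSet p q M P = M ∪ P.image (fun a => p + q + 1 - a) from rfl,
    Finset.sum_union (disjoint_image_reflect hpq hM hP),
    Finset.sum_image (reflect_injOn (subset_Icc_add hP))]
  have h1 : ∑ y ∈ M, rankIn (polToSet p q P M) y = deltaPol P M := by
    rw [deltaPol_eq_sum_right]
    refine Finset.sum_congr rfl fun y hy => ?_
    have hy' := Finset.mem_Icc.1 (hM hy)
    rw [rankIn_polToSet hpq hP hM, Finset.filter_false_of_mem (s := M), Finset.card_empty,
      add_zero, rankIn]
    · congr 1
      refine Finset.filter_congr fun x hx => ?_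
      have : x ≠ y := fun h => Finset.disjoint_left.1 hPM hx (h ▸ hy)
      omega
    · intro a ha
      have := Finset.mem_Icc.1 (hM ha)
      omega
  have h2 : ∑ a ∈ P, rankIn (polToSet p q P M) (p + q + 1 - a)
      = P.card ^ 2 + deltaPol P M := by
    rw [deltaPol_eq_sum_left, sq, ← smul_eq_mul, ← Finset.sum_const, ← Finset.sum_add_distrib]
    refine Finset.sum_congr rfl fun a ha => ?_
    have ha' := Finset.mem_Icc.1 (hP ha)
    rw [rankIn_polToSet hpq hP hM, rankIn, Finset.filter_true_of_mem]
    · congr 2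
      refine Finset.filter_congr fun b hb => ?_
      have hb' := Finset.mem_Icc.1 (hM hb)
      have : a ≠ b := fun h => Finset.disjoint_left.1 hPM ha (h ▸ hb)
      omega
    · intro x hx
      have := Finset.mem_Icc.1 (hP hx)
      omega
  rw [h1, h2]
  ring

variable {r : ℕ}

theorem primeSet_eq_image (hpq : q ≤ p) (hP : P ⊆ Finset.Icc 1 q) (hM : M ⊆ Finset.Icc 1 q)
    (hPM : Disjoint P M) (hr : P.card + M.card = r) :
    primeSet p q r (polToSet p q P M)
      = (polToSet p q M P).image (rankIn (Finset.Icc 1 (p + q) \ polToSet p q P M)) := by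
  have hc : (Finset.Icc 1 (p + q) \ polToSet p q P M).card = p + q - r := by
    rw [Finset.card_sdiff_of_subset (polToSet_subset hP hM), card_polToSet hpq hP hM, hr,
      Nat.card_Icc, Nat.add_sub_cancel]
  rw [primeSet, image_reflect_polToSet hM, ← hc]
  exact filter_sort_getD_mem (Finset.subset_sdiff.2
    ⟨polToSet_subset hM hP, disjoint_polToSet_swap hpq hP hM hPM⟩)

theorem primeSet_card_and_sum (hpq : q ≤ p) (hP : P ⊆ Finset.Icc 1 q)
    (hM : M ⊆ Finset.Icc 1 q) (hPM : Disjoint P M) (hr : P.card + M.card = r) :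
    (primeSet p q r (polToSet p q P M)).card = r ∧
    ∑ i ∈ primeSet p q r (polToSet p q P M), i + 2 * deltaPol P M + P.card ^ 2
      = ∑ y ∈ polToSet p q M P, y := by
  have hsub : polToSet p q M P ⊆ Finset.Icc 1 (p + q) \ polToSet p q P M :=
    Finset.subset_sdiff.2
      ⟨polToSet_subset hM hP, disjoint_polToSet_swap hpq hP hM hPM⟩
  have hinj := (rankIn_injOn (Finset.Icc 1 (p + q) \ polToSet p q P M)).mono
    (Finset.coe_subset.2 hsub)
  rw [primeSet_eq_image hpq hP hM hPM hr]
  constructor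
  · rw [Finset.card_image_of_injOn hinj, card_polToSet hpq hM hP, add_comm, hr]
  · rw [Finset.sum_image hinj, add_assoc, ← sum_rankIn_polToSet hpq hP hM hPM,
      ← Finset.sum_add_distrib]
    exact Finset.sum_congr rfl fun y hy => rankIn_sdiff_add (polToSet_subset hP hM)
      (Finset.mem_Icc.1 (polToSet_subset hM hP hy)).2

theorem primeSet_subset (p q r : ℕ) (S : Finset ℕ) :
    primeSet p q r S ⊆ Finset.Icc 1 (p + q - r) := Finset.filter_subset _ _

theorem tildeSet_eq_image (p q r : ℕ) (S : Finset ℕ) :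
    tildeSet p q r S = (primeSet p q r S).image fun i => p + q - r + 1 - i := by
  ext k
  simp only [tildeSet, Finset.mem_filter, Finset.mem_Icc, Finset.mem_image]
  constructor
  · rintro ⟨hk, h⟩
    exact ⟨_, h, by omega⟩
  · rintro ⟨i, hi, rfl⟩
    have hi' := Finset.mem_Icc.1 (primeSet_subset p q r S hi)
    refine ⟨by omega, ?_⟩
    rwa [show p + q - r + 1 - (p + q - r + 1 - i) = i by omega]

theorem card_tildeSet (hpq : q ≤ p) (hP : P ⊆ Finset.Icc 1 q) (hM : M ⊆ Finset.Icc 1 q)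
    (hPM : Disjoint P M) (hr : P.card + M.card = r) :
    (tildeSet p q r (polToSet p q P M)).card = r := by
  rw [tildeSet_eq_image, Finset.card_image_of_injOn (reflect_injOn (primeSet_subset p q r _)),
    (primeSet_card_and_sum hpq hP hM hPM hr).1]

theorem sum_tildeSet_add (hpq : q ≤ p) (hP : P ⊆ Finset.Icc 1 q) (hM : M ⊆ Finset.Icc 1 q)
    (hPM : Disjoint P M) (hr : P.card + M.card = r) (hrp : r ≤ p) :
    ∑ i ∈ tildeSet p q r (polToSet p q P M), i + r ^ 2
      = ∑ x ∈ polToSet p q P M, x + 2 * deltaPol P M + P.card ^ 2 := by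
  have h1 := sum_image_reflect_add (primeSet_subset p q r (polToSet p q P M))
  obtain ⟨hc, h2⟩ := primeSet_card_and_sum hpq hP hM hPM hr
  have h3 := sum_image_reflect_add (polToSet_subset (p := p) hP hM)
  rw [image_reflect_polToSet hM, card_polToSet hpq hP hM, hr] at h3
  rw [← tildeSet_eq_image, hc] at h1
  obtain ⟨k, rfl⟩ := Nat.exists_eq_add_of_le hrp
  rw [show r + k + q - r = k + q by omega] at h1
  nlinarith

end Polarized

/-- If the two Horn conditions of Theorem `th:singular-horn` hold for a triple
`I_•, J_•, K_•` of polarized subsets of `[q]` of cardinal `r`, then the identities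
(C2) `|I_+| + |J_+| + |K_+| − (|I_−| + |J_−| + |K_−|) + r(r+1)/2
      = (p+q+1)(♯I_+ + ♯J_+ + ♯K_+ − r)` and
(C3) `(♯I_+)² + (♯J_+)² + (♯K_+)² + 2(δ_{I_•} + δ_{J_•} + δ_{K_•}) = r²` hold. -/
theorem horn_conditions_C2_C3 (p q r : ℕ) (hq : 1 ≤ q) (hpq : q ≤ p)
    (hr1 : 1 ≤ r) (hrq : r ≤ q)
    (Ip Im Jp Jm Kp Km : Finset ℕ)
    (hI1 : Ip ⊆ Finset.Icc 1 q) (hI2 : Im ⊆ Finset.Icc 1 q) (hI3 : Disjoint Ip Im)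
    (hI4 : Ip.card + Im.card = r)
    (hJ1 : Jp ⊆ Finset.Icc 1 q) (hJ2 : Jm ⊆ Finset.Icc 1 q) (hJ3 : Disjoint Jp Jm)
    (hJ4 : Jp.card + Jm.card = r)
    (hK1 : Kp ⊆ Finset.Icc 1 q) (hK2 : Km ⊆ Finset.Icc 1 q) (hK3 : Disjoint Kp Km)
    (hK4 : Kp.card + Km.card = r)
    (hHorn1 : (lambdaOf (p + q) r (polToSet p q Ip Im),
        lambdaOf (p + q) r (polToSet p q Jp Jm),
        fun a => lambdaOf (p + q) r (polToSet p q Kp Km) a - ((p : ℝ) + q - r))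
          ∈ Horn r)
    (hHorn2 : (lambdaOf (p + q - r) r (tildeSet p q r (polToSet p q Ip Im)),
        lambdaOf (p + q - r) r (tildeSet p q r (polToSet p q Jp Jm)),
        fun a => lambdaOf (p + q - r) r (tildeSet p q r (polToSet p q Kp Km)) a
          - ((p : ℝ) + q - 2 * r)) ∈ Horn r) :
    ((∑ i ∈ Ip, (i : ℤ)) + (∑ i ∈ Jp, (i : ℤ)) + (∑ i ∈ Kp, (i : ℤ))
        - ((∑ i ∈ Im, (i : ℤ)) + (∑ i ∈ Jm, (i : ℤ)) + (∑ i ∈ Km, (i : ℤ)))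
        + ((r : ℤ) * (r + 1)) / 2
      = ((p : ℤ) + q + 1) * ((Ip.card : ℤ) + Jp.card + Kp.card - r)) ∧
    (Ip.card ^ 2 + Jp.card ^ 2 + Kp.card ^ 2
        + 2 * (deltaPol Ip Im + deltaPol Jp Jm + deltaPol Kp Km) = r ^ 2) := by
  have c1 := sum_eq_zero_of_mem_Horn hHorn1
  have c2 := sum_eq_zero_of_mem_Horn hHorn2
  have hrp := hrq.trans hpq
  have hcast : ((p + q - r : ℕ) : ℝ) = p + q - r := by
    rw [Nat.cast_sub (by omega)]
    push_cast
    ring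
  simp only [Finset.sum_sub_distrib, Finset.sum_const, Finset.card_univ, Fintype.card_fin,
    nsmul_eq_mul] at c1 c2
  rw [sum_lambdaOf _ ((card_polToSet hpq hI1 hI2).trans hI4),
    sum_lambdaOf _ ((card_polToSet hpq hJ1 hJ2).trans hJ4),
    sum_lambdaOf _ ((card_polToSet hpq hK1 hK2).trans hK4)] at c1
  rw [sum_lambdaOf _ (card_tildeSet hpq hI1 hI2 hI3 hI4),
    sum_lambdaOf _ (card_tildeSet hpq hJ1 hJ2 hJ3 hJ4),
    sum_lambdaOf _ (card_tildeSet hpq hK1 hK2 hK3 hK4), hcast] at c2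
  have tI := congrArg (Nat.cast (R := ℝ)) (sum_tildeSet_add hpq hI1 hI2 hI3 hI4 hrp)
  have tJ := congrArg (Nat.cast (R := ℝ)) (sum_tildeSet_add hpq hJ1 hJ2 hJ3 hJ4 hrp)
  have tK := congrArg (Nat.cast (R := ℝ)) (sum_tildeSet_add hpq hK1 hK2 hK3 hK4 hrp)
  have sI := congrArg (Nat.cast (R := ℝ)) (sum_polToSet_add hpq hI1 hI2)
  have sJ := congrArg (Nat.cast (R := ℝ)) (sum_polToSet_add hpq hJ1 hJ2)
  have sK := congrArg (Nat.cast (R := ℝ)) (sum_polToSet_add hpq hK1 hK2)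
  have mI : (Im.card : ℝ) = r - Ip.card := by rw [← hI4]; push_cast; ring
  have mJ : (Jm.card : ℝ) = r - Jp.card := by rw [← hJ4]; push_cast; ring
  have mK : (Km.card : ℝ) = r - Kp.card := by rw [← hK4]; push_cast; ring
  simp only [Nat.cast_add, Nat.cast_mul, Nat.cast_pow, Nat.cast_ofNat, Nat.cast_one, mI, mJ, mK]
    at c1 c2 tI tJ tK sI sJ sK
  constructor
  · obtain ⟨h, hh⟩ : (2 : ℤ) ∣ (r : ℤ) * (r + 1) := (Int.even_mul_succ_self r).two_dvd
    have hh' : (r : ℝ) * (r + 1) = 2 * h := by exact_mod_cast hh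
    rw [hh, Int.mul_ediv_cancel_left _ two_ne_zero]
    rify
    push_cast at *
    linarith
  · rify
    linarith
end
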